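/- Let d ≥ 1 and let (S_z, J_z, h_z), z ∈ [z_c−δ, z_c), be a critical family with constants M, K, ζ, such that in addition ĥ_z^{(μ)}(0) ≥ M⁻¹ for all z ∈ [z_c−δ, z_c) and all μ ∈ Ω̄_z, and such that σ_z² → σ*² and ĥ_z(0) → h* as z → z_c⁻ for some σ*, h* > 0. Then for every φ ≥ 0, m_z^{2+φ} ∑_{x∈ℤ^d} ‖x‖₂^φ S_z(x) → A_φ d h*/σ*² as z → z_c⁻. Consequently, for every φ > 0, m_z ξ_φ(z) → (A_φ/A₀)^{1/φ} = 2(Γ((φ+2)/2) Γ((φ+d)/2)/Γ(d/2))^{1/φ} as z → z_c⁻, where Γ is the Gamma function. -/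

import Mathlib

open scoped BigOperators ENNReal Real Topology Pointwise
open MeasureTheory Matrix Filter

noncomputable section

namespace OZpaper

variable {d : ℕ}

/-- Dot product of a real vector with a lattice point. -/
def rdotZ (μ : Fin d → ℝ) (x : Fin d → ℤ) : ℝ := ∑ i, μ i * (x i : ℝ)

/-- Dot product of two real vectors. -/
def rdot (μ x : Fin d → ℝ) : ℝ := ∑ i, μ i * x i

/-- Euclidean norm of a lattice point. -/
def enormZ (x : Fin d → ℤ) : ℝ := Real.sqrt (∑ i, ((x i : ℝ)) ^ 2)

/-- Euclidean norm of a real vector. -/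
def enormR (x : Fin d → ℝ) : ℝ := Real.sqrt (∑ i, (x i) ^ 2)

/-- ℓ¹ norm of a real vector. -/
def l1R (x : Fin d → ℝ) : ℝ := ∑ i, |x i|

/-- ℓ∞ norm of a real vector. -/
def linftyR (x : Fin d → ℝ) : ℝ := ⨆ i, |x i|

/-- The vector `t • e₁`. -/
def e1R (d : ℕ) (t : ℝ) : Fin d → ℝ := fun i => if (i : ℕ) = 0 then t else 0

/-- The lattice point `n • e₁`. -/
def e1Z (d : ℕ) (n : ℤ) : Fin d → ℤ := fun i => if (i : ℕ) = 0 then n else 0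

/-- Cast of a lattice point to a real vector. -/
def toR (x : Fin d → ℤ) : Fin d → ℝ := fun i => (x i : ℝ)

/-- ℤ^d-symmetry: invariance under coordinate permutations and sign flips. -/
def ZdSymmetric (f : (Fin d → ℤ) → ℝ) : Prop :=
  (∀ (σ : Equiv.Perm (Fin d)) (x : Fin d → ℤ), f (fun i => x (σ i)) = f x) ∧
  (∀ (ε : Fin d → Bool) (x : Fin d → ℤ), f (fun i => if ε i then -(x i) else x i) = f x)

/-- Tilted susceptibility `χ^{(μ)}`, valued in `ℝ≥0∞`. -/
def chi (S : (Fin d → ℤ) → ℝ) (μ : Fin d → ℝ) : ℝ≥0∞ :=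
  ∑' x, ENNReal.ofReal (S x * Real.exp (rdotZ μ x))

/-- The set `Ω = {μ : χ^{(μ)} < ∞}`. -/
def Omega (S : (Fin d → ℤ) → ℝ) : Set (Fin d → ℝ) := {μ | chi S μ < ⊤}

/-- The mass `m_S`. -/
def mass (S : (Fin d → ℤ) → ℝ) : ℝ := sSup {t : ℝ | 0 ≤ t ∧ chi S (e1R d t) < ⊤}

/-- Assumption Ω. -/
structure AssumptionOmega (S : (Fin d → ℤ) → ℝ) : Prop where
  nonneg : ∀ x, 0 ≤ S x
  symm : ZdSymmetric S
  open_Omega : IsOpen (Omega S)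
  zero_mem : (0 : Fin d → ℝ) ∈ Omega S
  exists_not_mem : ∃ μ₁ : ℝ, 0 < μ₁ ∧ e1R d μ₁ ∉ Omega S

/-- Fourier transform `Q̂(k) = ∑_y Q(y) e^{-i k·y}`. -/
def fourierZ (Q : (Fin d → ℤ) → ℝ) (k : Fin d → ℝ) : ℂ :=
  ∑' y, (Q y : ℂ) * Complex.exp (-Complex.I * (rdotZ k y : ℂ))

/-- ℓ^p norm of a function on ℤ^d, valued in `ℝ≥0∞`. -/
def lpNorm (f : (Fin d → ℤ) → ℝ) (p : ℝ) : ℝ≥0∞ :=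
  (∑' y, ENNReal.ofReal (|f y| ^ p)) ^ (1 / p)

/-- The exponent `p_d`. -/
def pExp (d : ℕ) (ζ : ℝ) : ℝ := if d = 1 then 2 else (d : ℝ) / ((d : ℝ) - 2 + min ζ 2)

/-- The class 𝒬_{M,K,ζ} without the (d-1)-th moment bounds. -/
structure MemQweak (M K ζ : ℝ) (Q g : (Fin d → ℤ) → ℝ) : Prop where
  Q_l1 : lpNorm Q 1 ≤ ENNReal.ofReal M
  Q_moment : lpNorm (fun y => enormZ y ^ (2 + ζ) * Q y) 1 ≤ ENNReal.ofReal M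
  infrared : ∀ k : Fin d → ℝ, (∀ i, |k i| ≤ π) →
    K * enormR k ^ 2 ≤ (fourierZ Q 0 - fourierZ Q k).re
  g_l1 : lpNorm g 1 ≤ ENNReal.ofReal M
  g_zeta : lpNorm (fun y => enormZ y ^ ζ * g y) 1 ≤ ENNReal.ofReal M
  g_two : lpNorm (fun y => enormZ y ^ (2 : ℝ) * g y) (min (pExp d ζ) 2) ≤ ENNReal.ofReal M

/-- The class 𝒬_{M,K,ζ}. -/
structure MemQ (M K ζ : ℝ) (Q g : (Fin d → ℤ) → ℝ) : Prop where
  Q_l1 : lpNorm Q 1 ≤ ENNReal.ofReal M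
  Q_moment : lpNorm (fun y => enormZ y ^ (2 + ζ) * Q y) 1 ≤ ENNReal.ofReal M
  infrared : ∀ k : Fin d → ℝ, (∀ i, |k i| ≤ π) →
    K * enormR k ^ 2 ≤ (fourierZ Q 0 - fourierZ Q k).re
  g_l1 : lpNorm g 1 ≤ ENNReal.ofReal M
  g_zeta : lpNorm (fun y => enormZ y ^ ζ * g y) 1 ≤ ENNReal.ofReal M
  g_two : lpNorm (fun y => enormZ y ^ (2 : ℝ) * g y) (min (pExp d ζ) 2) ≤ ENNReal.ofReal M
  Q_dm1 : 4 ≤ d →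
    lpNorm (fun y => enormZ y ^ ((d : ℝ) - 1) * Q y) (min ((d : ℝ) / 3) 2) ≤ ENNReal.ofReal M
  g_dm1 : 4 ≤ d →
    lpNorm (fun y => enormZ y ^ ((d : ℝ) - 1) * g y) 2 ≤ ENNReal.ofReal M

/-- Convolution on ℤ^d. -/
def conv (f g : (Fin d → ℤ) → ℝ) (x : Fin d → ℤ) : ℝ := ∑' y, f (x - y) * g y

/-- Exponential tilt `f^{(μ)}`. -/
def tilt (f : (Fin d → ℤ) → ℝ) (μ : Fin d → ℝ) : (Fin d → ℤ) → ℝ :=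
  fun x => f x * Real.exp (rdotZ μ x)

/-- `∑_y f(y) e^{μ·y}`, i.e. `f̂^{(μ)}(0)`. -/
def tiltSum (f : (Fin d → ℤ) → ℝ) (μ : Fin d → ℝ) : ℝ := ∑' y, f y * Real.exp (rdotZ μ y)

/-- Assumption J. -/
structure AssumptionJ (S J h : (Fin d → ℤ) → ℝ) (M K ζ : ℝ) : Prop where
  M_pos : 0 < M
  K_pos : 0 < K
  zeta_pos : 0 < ζ
  J_symm : ZdSymmetric J
  h_symm : ZdSymmetric h
  J_summable : Summable fun x => |J x|
  h_summable : Summable fun x => |h x|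
  OZ_eq : ∀ x, S x = h x + conv J S x
  memQ : ∀ μ ∈ closure (Omega S), MemQ M K ζ (tilt J μ) (tilt h μ)
  hhat_pos : ∀ μ ∈ closure (Omega S), 0 < tiltSum h μ

/-- Assumption J, without the (d-1)-th moment bounds of the class 𝒬. -/
structure AssumptionJweak (S J h : (Fin d → ℤ) → ℝ) (M K ζ : ℝ) : Prop where
  M_pos : 0 < M
  K_pos : 0 < K
  zeta_pos : 0 < ζ
  J_symm : ZdSymmetric J
  h_symm : ZdSymmetric h
  J_summable : Summable fun x => |J x|
  h_summable : Summable fun x => |h x|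
  OZ_eq : ∀ x, S x = h x + conv J S x
  memQ : ∀ μ ∈ closure (Omega S), MemQweak M K ζ (tilt J μ) (tilt h μ)
  hhat_pos : ∀ μ ∈ closure (Omega S), 0 < tiltSum h μ

/-- `μ` is the optimal tilt `μ_x̂` for direction `x`. -/
def IsOptTilt (S : (Fin d → ℤ) → ℝ) (x μ : Fin d → ℝ) : Prop :=
  μ ∈ frontier (Omega S) ∧ ∀ ν ∈ closure (Omega S), rdot ν x ≤ rdot μ x

/-- The norm `|x|_S = (max_{μ ∈ Ω̄} μ·x)/m_S`. -/
def normS (S : (Fin d → ℤ) → ℝ) (x : Fin d → ℝ) : ℝ :=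
  sSup ((fun μ => rdot μ x) '' closure (Omega S)) / mass S

/-- The drift vector `η` of the tilted kernel. -/
def etaOf (J : (Fin d → ℤ) → ℝ) (μ : Fin d → ℝ) : Fin d → ℝ :=
  fun j => ∑' y, (y j : ℝ) * J y * Real.exp (rdotZ μ y)

/-- The covariance matrix `Λ` of the tilted kernel. -/
def LambdaOf (J : (Fin d → ℤ) → ℝ) (μ : Fin d → ℝ) : Matrix (Fin d) (Fin d) ℝ :=
  Matrix.of fun j l => ∑' y, (y j : ℝ) * (y l : ℝ) * J y * Real.exp (rdotZ μ y)

/-- The Brownian heat kernel `ρ_t(x; η, Λ)`. -/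
def heatKer (d : ℕ) (t : ℝ) (x η : Fin d → ℝ) (Λ : Matrix (Fin d) (Fin d) ℝ) : ℝ :=
  (1 / Real.sqrt Λ.det) * (1 / (2 * π * t) ^ ((d : ℝ) / 2)) *
    Real.exp (-(1 / (2 * t)) * rdot (x - t • η) (Λ⁻¹ *ᵥ (x - t • η)))

/-- The Brownian Green function `𝒞(x; η, Λ)`. -/
def greenC (d : ℕ) (x η : Fin d → ℝ) (Λ : Matrix (Fin d) (Fin d) ℝ) : ℝ :=
  ∫ t in Set.Ioi (0 : ℝ), heatKer d t x η Λ

/-- The massive continuum Green function `𝔾_a(x)`. -/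
def massiveG (d : ℕ) (a : ℝ) (x : Fin d → ℝ) : ℝ :=
  ∫ t in Set.Ioi (0 : ℝ),
    (1 / (2 * π * t) ^ ((d : ℝ) / 2)) * Real.exp (-enormR x ^ 2 / (2 * t)) *
      Real.exp (-(t * a ^ 2) / 2)

/-- The constant `A_φ = ∫_{ℝ^d} ‖y‖₂^φ 𝔾₁(y) dy`. -/
def Aconst (d : ℕ) (φ : ℝ) : ℝ := ∫ y : Fin d → ℝ, enormR y ^ φ * massiveG d 1 y

/-- The torus `[-π, π]^d`. -/
def torus (d : ℕ) : Set (Fin d → ℝ) := Set.univ.pi fun _ => Set.Icc (-π) π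

/-- The Fourier integral `I_t(x)`. -/
def It (Q g : (Fin d → ℤ) → ℝ) (t : ℝ) (x : Fin d → ℤ) : ℂ :=
  (((2 * π) ^ d : ℝ) : ℂ)⁻¹ *
    ∫ k in torus d, Complex.exp (Complex.I * (rdotZ k x : ℂ)) * fourierZ g k *
      Complex.exp (-(t : ℂ) * (fourierZ Q 0 - fourierZ Q k))

/-- The quantity `G_Q(x)`. -/
def GQ (Q g : (Fin d → ℤ) → ℝ) (x : Fin d → ℤ) : ℂ :=
  ∫ t in Set.Ioi (0 : ℝ), It Q g t x

/-- The Kronecker delta at the origin. -/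
def deltaZ (d : ℕ) : (Fin d → ℤ) → ℝ := fun x => if x = 0 then 1 else 0

/-- n-fold convolution power. -/
def convPow (D : (Fin d → ℤ) → ℝ) : ℕ → (Fin d → ℤ) → ℝ
  | 0 => deltaZ d
  | n + 1 => conv D (convPow D n)

/-- Random-walk Green function `S_z(x) = ∑_n z^n D^{*n}(x)`. -/
def rwG (D : (Fin d → ℤ) → ℝ) (z : ℝ) (x : Fin d → ℤ) : ℝ :=
  ∑' n : ℕ, z ^ n * convPow D n x

/-- `σ² = ∑_x ‖x‖₂² J(x)`. -/
def sigmaSq (J : (Fin d → ℤ) → ℝ) : ℝ := ∑' x, enormZ x ^ 2 * J x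

/-- Susceptibility `χ = ∑_x S(x)`. -/
def suscept (S : (Fin d → ℤ) → ℝ) : ℝ := ∑' x, S x

/-- `ĥ(0) = ∑_x h(x)`. -/
def h0 (h : (Fin d → ℤ) → ℝ) : ℝ := ∑' x, h x

/-- Correlation length of order φ. -/
def xiPhi (S : (Fin d → ℤ) → ℝ) (φ : ℝ) : ℝ :=
  ((∑' x, enormZ x ^ φ * S x) / suscept S) ^ (1 / φ)

/-- A critical family of OZ systems. -/
structure CriticalFamily (d : ℕ) (δ zc M K ζ : ℝ) (S J h : ℝ → (Fin d → ℤ) → ℝ) : Prop where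
  δ_pos : 0 < δ
  assumOmega : ∀ z ∈ Set.Ico (zc - δ) zc, AssumptionOmega (S z)
  assumJ : ∀ z ∈ Set.Ico (zc - δ) zc, AssumptionJ (S z) (J z) (h z) M K ζ
  mass_tendsto : Tendsto (fun z => mass (S z)) (𝓝[<] zc) (𝓝 0)

/-- Convolution on ℤ. -/
def convZ (f g : ℤ → ℝ) (x : ℤ) : ℝ := ∑' y, f (x - y) * g y

/-- n-fold convolution power on ℤ. -/
def convZPow (f : ℤ → ℝ) : ℕ → ℤ → ℝ
  | 0 => fun x => if x = 0 then 1 else 0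
  | n + 1 => convZ f (convZPow f n)

/-- Weak convergence together with a uniform second-moment bound gives convergence of integrals. -/
theorem tendsto_integral_of_sq_bounded {E : Type*} [MeasurableSpace E] [TopologicalSpace E]
    [OpensMeasurableSpace E] {P : ℕ → ProbabilityMeasure E} {P₀ : ProbabilityMeasure E}
    (hP : Tendsto P atTop (𝓝 P₀)) {f : E → ℝ} (hf : Continuous f) (hf0 : ∀ x, 0 ≤ f x) {C : ℝ}
    (hint : ∀ n, Integrable (fun x => f x ^ 2) (P n : Measure E))
    (hC : ∀ᶠ n in atTop, ∫ x, f x ^ 2 ∂(P n : Measure E) ≤ C)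
    (hint₀ : Integrable (fun x => f x ^ 2) (P₀ : Measure E)) :
    Tendsto (fun n => ∫ x, f x ∂(P n : Measure E)) atTop (𝓝 (∫ x, f x ∂(P₀ : Measure E))) := by
  set C' := max C (∫ x, f x ^ 2 ∂(P₀ : Measure E)) with hC'
  have key : ∀ (Q : ProbabilityMeasure E), Integrable (fun x => f x ^ 2) (Q : Measure E) →
      ∫ x, f x ^ 2 ∂(Q : Measure E) ≤ C' → ∀ R : ℝ, 0 < R →
      |∫ x, f x ∂(Q : Measure E) - ∫ x, min (f x) R ∂(Q : Measure E)| ≤ C' / R := by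
    intro Q hQ hQC R hR
    have hfi : Integrable f (Q : Measure E) := by
      refine Integrable.mono' (hQ.add (integrable_const (1 : ℝ))) hf.aestronglyMeasurable
        (.of_forall fun x => ?_)
      rw [Real.norm_of_nonneg (hf0 x)]
      simp only [Pi.add_apply]
      nlinarith [sq_nonneg (f x - 1), hf0 x]
    have hmi : Integrable (fun x => min (f x) R) (Q : Measure E) := by
      refine hfi.mono' (hf.min continuous_const).aestronglyMeasurable (.of_forall fun x => ?_)
      rw [Real.norm_of_nonneg (le_min (hf0 x) hR.le)]
      exact min_le_left _ _
    rw [← integral_sub hfi hmi, abs_of_nonneg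
      (integral_nonneg fun x => sub_nonneg.2 (min_le_left _ _))]
    calc _ ≤ ∫ x, f x ^ 2 / R ∂(Q : Measure E) := by
          refine integral_mono (hfi.sub hmi) (hQ.div_const R) fun x => ?_
          simp only
          rw [le_div_iff₀ hR]
          rcases le_total (f x) R with h | h
          · rw [min_eq_left h]; nlinarith [sq_nonneg (f x)]
          · rw [min_eq_right h]; nlinarith [hf0 x]
      _ = (∫ x, f x ^ 2 ∂(Q : Measure E)) / R := integral_div _ _
      _ ≤ C' / R := by gcongr
  rw [Metric.tendsto_atTop]
  intro ε hε
  have hC'0 : 0 ≤ C' := le_max_of_le_right (integral_nonneg fun x => sq_nonneg _)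
  obtain ⟨R, hR, hRε⟩ : ∃ R : ℝ, 0 < R ∧ C' / R < ε / 4 := by
    refine ⟨4 * C' / ε + 1, by positivity, ?_⟩
    rw [div_lt_iff₀ (by positivity)]
    have : ε / 4 * (4 * C' / ε + 1) = C' + ε / 4 := by field_simp
    linarith
  let g : BoundedContinuousFunction E ℝ := BoundedContinuousFunction.ofNormedAddCommGroup
    (fun x => min (f x) R) (hf.min continuous_const) R fun x => by
      rw [Real.norm_of_nonneg (le_min (hf0 x) hR.le)]; exact min_le_right _ _
  have hg := (ProbabilityMeasure.tendsto_iff_forall_integral_tendsto.1 hP) g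
  obtain ⟨N, hN⟩ := (Metric.tendsto_atTop.1 hg) (ε / 4) (by positivity)
  obtain ⟨N', hN'⟩ := eventually_atTop.1 hC
  refine ⟨max N N', fun n hn => ?_⟩
  have h1 := key (P n) (hint n) ((hN' n ((le_max_right _ _).trans hn)).trans (le_max_left _ _)) R hR
  have h2 := key P₀ hint₀ (le_max_right _ _) R hR
  have h3 := hN n ((le_max_left _ _).trans hn)
  rw [Real.dist_eq] at h3 ⊢
  have h3' : |∫ x, min (f x) R ∂(P n : Measure E) - ∫ x, min (f x) R ∂(P₀ : Measure E)| < ε / 4 := h3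
  rw [abs_le] at h1 h2
  rw [abs_lt] at h3' ⊢
  constructor <;> linarith [h1.1, h1.2, h2.1, h2.2, h3'.1, h3'.2]

/-- Euclidean space of dimension `d`. -/
abbrev Euc (d : ℕ) := EuclideanSpace ℝ (Fin d)

theorem integrable_norm_rpow_mul_exp (hd : 1 ≤ d) {q b : ℝ} (hq : 0 ≤ q) (hb : 0 < b) :
    Integrable fun y : Euc d => ‖y‖ ^ q * Real.exp (-b * ‖y‖ ^ 2) := by
  have : Nonempty (Fin d) := ⟨⟨0, hd⟩⟩
  rw [integrable_fun_norm_addHaar (μ := (volume : Measure (Euc d)))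
    (f := fun r => r ^ q * Real.exp (-b * r ^ 2))]
  have h := integrableOn_rpow_mul_exp_neg_mul_sq hb (s := (d : ℝ) - 1 + q) (by
    have : (1 : ℝ) ≤ d := by exact_mod_cast hd
    linarith)
  refine h.congr_fun (fun r hr => ?_) measurableSet_Ioi
  have hr : 0 < r := hr
  have e : ((d : ℝ) - 1) = ((d - 1 : ℕ) : ℝ) := by push_cast [Nat.cast_sub hd]; ring
  simp only [finrank_euclideanSpace, Fintype.card_fin, smul_eq_mul]
  rw [Real.rpow_add hr, e, Real.rpow_natCast]; ring

theorem integral_norm_rpow_mul_exp_aux (hd : 1 ≤ d) {q b : ℝ} (hq : 0 ≤ q) (hb : 0 < b) :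
    ∫ y : Euc d, ‖y‖ ^ q * Real.exp (-b * ‖y‖ ^ 2) =
      d * (volume : Measure (Euc d)).real (Metric.ball 0 1) *
        (b ^ (-((d : ℝ) + q) / 2) * (1 / 2) * Real.Gamma (((d : ℝ) + q) / 2)) := by
  have : Nonempty (Fin d) := ⟨⟨0, hd⟩⟩
  have hd' : (1 : ℝ) ≤ d := by exact_mod_cast hd
  rw [integral_fun_norm_addHaar (volume : Measure (Euc d))
    (fun r => r ^ q * Real.exp (-b * r ^ 2))]
  have h := integral_rpow_mul_exp_neg_mul_rpow (p := 2) (q := (d : ℝ) - 1 + q) (b := b)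
    (by norm_num) (by linarith) hb
  have e1 : (d : ℝ) - 1 + q + 1 = d + q := by ring
  rw [e1] at h
  rw [← h]
  simp only [finrank_euclideanSpace, Fintype.card_fin, smul_eq_mul, nsmul_eq_mul]
  rw [mul_assoc]
  congr 2
  refine setIntegral_congr_fun measurableSet_Ioi fun r hr => ?_
  have hr : 0 < r := hr
  have e : ((d : ℝ) - 1) = ((d - 1 : ℕ) : ℝ) := by push_cast [Nat.cast_sub hd]; ring
  rw [Real.rpow_add hr, e, Real.rpow_natCast, Real.rpow_two]; ring

theorem integral_norm_rpow_mul_exp (hd : 1 ≤ d) {q b : ℝ} (hq : 0 ≤ q) (hb : 0 < b) :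
    ∫ y : Euc d, ‖y‖ ^ q * Real.exp (-b * ‖y‖ ^ 2) =
      π ^ ((d : ℝ) / 2) * b ^ (-((d : ℝ) + q) / 2) *
        (Real.Gamma (((d : ℝ) + q) / 2) / Real.Gamma ((d : ℝ) / 2)) := by
  have hd' : (0 : ℝ) < d := by exact_mod_cast hd
  have h0 := integral_norm_rpow_mul_exp_aux hd (q := 0) le_rfl (b := 1) one_pos
  have h1 := GaussianFourier.integral_rexp_neg_mul_sq_norm (V := Euc d) (b := 1) one_pos
  simp only [Real.rpow_zero, one_mul] at h0
  rw [h0] at h1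
  simp only [add_zero, Real.one_rpow, one_mul, finrank_euclideanSpace, Fintype.card_fin,
    div_one] at h1
  have hG : 0 < Real.Gamma ((d : ℝ) / 2) := Real.Gamma_pos_of_pos (by positivity)
  rw [integral_norm_rpow_mul_exp_aux hd hq hb, ← h1]
  field_simp

/-- The isotropic Gaussian density of variance `t`. -/
def gaussDens (d : ℕ) (t : ℝ) (y : Euc d) : ℝ :=
  (1 / (2 * π * t) ^ ((d : ℝ) / 2)) * Real.exp (-‖y‖ ^ 2 / (2 * t))

theorem gaussDens_nonneg {t : ℝ} (ht : 0 < t) (y : Euc d) : 0 ≤ gaussDens d t y := by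
  unfold gaussDens; positivity

theorem norm_rpow_mul_gaussDens (q t : ℝ) (y : Euc d) :
    ‖y‖ ^ q * gaussDens d t y = (1 / (2 * π * t) ^ ((d : ℝ) / 2)) *
      (‖y‖ ^ q * Real.exp (-(1 / (2 * t)) * ‖y‖ ^ 2)) := by
  unfold gaussDens
  have : -‖y‖ ^ 2 / (2 * t) = -(1 / (2 * t)) * ‖y‖ ^ 2 := by ring
  rw [this]; ring

theorem integrable_norm_rpow_mul_gaussDens (hd : 1 ≤ d) {q t : ℝ} (hq : 0 ≤ q) (ht : 0 < t) :
    Integrable fun y : Euc d => ‖y‖ ^ q * gaussDens d t y := by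
  simp_rw [norm_rpow_mul_gaussDens]
  exact (integrable_norm_rpow_mul_exp hd hq (by positivity)).const_mul _

theorem integral_norm_rpow_mul_gaussDens (hd : 1 ≤ d) {q t : ℝ} (hq : 0 ≤ q) (ht : 0 < t) :
    ∫ y : Euc d, ‖y‖ ^ q * gaussDens d t y =
      (2 * t) ^ (q / 2) * (Real.Gamma (((d : ℝ) + q) / 2) / Real.Gamma ((d : ℝ) / 2)) := by
  simp_rw [norm_rpow_mul_gaussDens]
  rw [integral_const_mul, integral_norm_rpow_mul_exp hd hq (by positivity)]
  have h2t : 0 < 2 * t := by positivity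
  have e1 : (1 / (2 * t)) ^ (-((d : ℝ) + q) / 2) = (2 * t) ^ ((d : ℝ) / 2) * (2 * t) ^ (q / 2) := by
    rw [one_div, Real.inv_rpow h2t.le, ← Real.rpow_neg h2t.le, ← Real.rpow_add h2t]
    congr 1; ring
  have e2 : (2 * π * t) ^ ((d : ℝ) / 2) = π ^ ((d : ℝ) / 2) * (2 * t) ^ ((d : ℝ) / 2) := by
    rw [← Real.mul_rpow Real.pi_pos.le h2t.le]; congr 1; ring
  rw [e1, e2]
  have := Real.rpow_pos_of_pos Real.pi_pos ((d : ℝ) / 2)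
  have := Real.rpow_pos_of_pos h2t ((d : ℝ) / 2)
  field_simp

/-- The integrand of the massive Green function of unit mass. -/
def massInt (d : ℕ) (t : ℝ) (y : Euc d) : ℝ := gaussDens d t y * Real.exp (-t / 2)

theorem measurable_massInt : Measurable fun p : ℝ × Euc d => massInt d p.1 p.2 := by
  unfold massInt gaussDens
  fun_prop

theorem massiveG_eq (y : Euc d) :
    massiveG d 1 (WithLp.ofLp y) = ∫ t in Set.Ioi (0 : ℝ), massInt d t y := by
  unfold massiveG massInt gaussDens
  simp [enormR, EuclideanSpace.norm_eq]

theorem massiveG_nonneg (x : Fin d → ℝ) : 0 ≤ massiveG d 1 x := by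
  refine setIntegral_nonneg measurableSet_Ioi fun t ht => ?_
  have : (0 : ℝ) < t := ht
  positivity

theorem integrableOn_rpow_mul_exp_half {s : ℝ} (hs : 0 ≤ s) :
    IntegrableOn (fun t : ℝ => (2 * t) ^ s * Real.exp (-t / 2)) (Set.Ioi 0) := by
  have h := integrableOn_rpow_mul_exp_neg_mul_rpow (p := 1) (b := 1 / 2) (s := s)
    (by linarith) one_pos (by norm_num)
  refine IntegrableOn.congr_fun (h.const_mul (2 ^ s)) (fun t ht => ?_) measurableSet_Ioi
  have ht : (0 : ℝ) < t := ht
  simp only [Real.rpow_one]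
  rw [Real.mul_rpow two_pos.le ht.le, show -(1 / 2 : ℝ) * t = -t / 2 by ring]; ring

theorem integral_rpow_mul_exp_half {s : ℝ} (hs : 0 ≤ s) :
    ∫ t in Set.Ioi (0 : ℝ), (2 * t) ^ s * Real.exp (-t / 2) =
      2 ^ (2 * s + 1) * Real.Gamma (s + 1) := by
  have h := Real.integral_rpow_mul_exp_neg_mul_Ioi (a := s + 1) (r := 1 / 2)
    (by linarith) (by norm_num)
  rw [show (1 / (1 / 2 : ℝ)) = 2 by norm_num] at h
  have e : (2 : ℝ) ^ (2 * s + 1) = 2 ^ s * 2 ^ (s + 1) := by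
    rw [← Real.rpow_add two_pos]; congr 1; ring
  rw [e, mul_assoc, ← h, ← integral_const_mul]
  refine setIntegral_congr_fun measurableSet_Ioi fun t ht => ?_
  have ht : (0 : ℝ) < t := ht
  simp only [add_sub_cancel_right]
  rw [Real.mul_rpow two_pos.le ht.le, show -(1 / 2 * t : ℝ) = -t / 2 by ring]; ring

theorem integrable_norm_rpow_mul_massInt (hd : 1 ≤ d) {q : ℝ} (hq : 0 ≤ q) :
    Integrable (fun p : ℝ × Euc d => ‖p.2‖ ^ q * massInt d p.1 p.2)
      ((volume.restrict (Set.Ioi (0 : ℝ))).prod volume) := by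
  have hm : Measurable fun p : ℝ × Euc d => ‖p.2‖ ^ q * massInt d p.1 p.2 :=
    (measurable_snd.norm.pow_const q).mul measurable_massInt
  rw [integrable_prod_iff hm.aestronglyMeasurable]
  constructor
  · filter_upwards [ae_restrict_mem measurableSet_Ioi] with t ht
    simp only [massInt, ← mul_assoc]
    exact (integrable_norm_rpow_mul_gaussDens hd hq ht).mul_const _
  · refine IntegrableOn.congr_fun ((integrableOn_rpow_mul_exp_half (s := q / 2)
      (by positivity)).mul_const
        (Real.Gamma (((d : ℝ) + q) / 2) / Real.Gamma ((d : ℝ) / 2))) (fun t ht => ?_)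
      measurableSet_Ioi
    have ht : (0 : ℝ) < t := ht
    have : ∀ y : Euc d, ‖‖y‖ ^ q * massInt d t y‖ = ‖y‖ ^ q * gaussDens d t y * Real.exp (-t / 2) := by
      intro y
      have := gaussDens_nonneg ht y
      rw [Real.norm_of_nonneg (by unfold massInt; positivity), massInt]; ring
    simp_rw [this]
    rw [integral_mul_const, integral_norm_rpow_mul_gaussDens hd hq ht]; ring

theorem integral_norm_rpow_mul_massiveG (hd : 1 ≤ d) {q : ℝ} (hq : 0 ≤ q) :
    ∫ y : Euc d, ‖y‖ ^ q * massiveG d 1 (WithLp.ofLp y) =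
      2 ^ (q + 1) * (Real.Gamma ((q + 2) / 2) *
        Real.Gamma ((q + (d : ℝ)) / 2) / Real.Gamma ((d : ℝ) / 2)) := by
  simp_rw [massiveG_eq, ← integral_const_mul]
  rw [← integral_integral_swap (f := fun (t : ℝ) (y : Euc d) => ‖y‖ ^ q * massInt d t y)
    (integrable_norm_rpow_mul_massInt hd hq)]
  have : ∀ t ∈ Set.Ioi (0 : ℝ), ∫ y : Euc d, ‖y‖ ^ q * massInt d t y =
      (2 * t) ^ (q / 2) * Real.exp (-t / 2) *
        (Real.Gamma (((d : ℝ) + q) / 2) / Real.Gamma ((d : ℝ) / 2)) := by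
    intro t ht
    simp only [massInt, ← mul_assoc]
    rw [integral_mul_const, integral_norm_rpow_mul_gaussDens hd hq ht]; ring
  rw [setIntegral_congr_fun measurableSet_Ioi this, integral_mul_const,
    integral_rpow_mul_exp_half (by positivity), show 2 * (q / 2) + 1 = q + 1 by ring,
    show q / 2 + 1 = (q + 2) / 2 by ring, show (d : ℝ) + q = q + d by ring]
  ring

theorem integrable_norm_rpow_mul_massiveG (hd : 1 ≤ d) {q : ℝ} (hq : 0 ≤ q) :
    Integrable fun y : Euc d => ‖y‖ ^ q * massiveG d 1 (WithLp.ofLp y) := by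
  simp_rw [massiveG_eq, ← integral_const_mul]
  exact (integrable_norm_rpow_mul_massInt hd hq).integral_prod_right

theorem Aconst_eq_integral (q : ℝ) :
    Aconst d q = ∫ y : Euc d, ‖y‖ ^ q * massiveG d 1 (WithLp.ofLp y) := by
  unfold Aconst
  rw [← (PiLp.volume_preserving_ofLp (Fin d)).integral_comp
    (MeasurableEquiv.toLp 2 _).symm.measurableEmbedding]
  simp [enormR, EuclideanSpace.norm_eq]

theorem Aconst_eq (hd : 1 ≤ d) {q : ℝ} (hq : 0 ≤ q) :
    Aconst d q = 2 ^ (q + 1) * (Real.Gamma ((q + 2) / 2) *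
        Real.Gamma ((q + (d : ℝ)) / 2) / Real.Gamma ((d : ℝ) / 2)) := by
  rw [Aconst_eq_integral, integral_norm_rpow_mul_massiveG hd hq]

theorem Aconst_zero (hd : 1 ≤ d) : Aconst d 0 = 2 := by
  have hd' : (0 : ℝ) < d := by exact_mod_cast hd
  have hG : 0 < Real.Gamma ((d : ℝ) / 2) := Real.Gamma_pos_of_pos (by positivity)
  rw [Aconst_eq hd le_rfl]
  simp [hG.ne']

theorem Aconst_ratio_rpow (hd : 1 ≤ d) {q : ℝ} (hq : 0 < q) :
    (Aconst d q / Aconst d 0) ^ (1 / q) =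
        2 * (Real.Gamma ((q + 2) / 2) * Real.Gamma ((q + (d : ℝ)) / 2) /
          Real.Gamma ((d : ℝ) / 2)) ^ (1 / q) := by
  have hd' : (0 : ℝ) < d := by exact_mod_cast hd
  have hG : 0 < Real.Gamma ((d : ℝ) / 2) := Real.Gamma_pos_of_pos (by positivity)
  have hG1 : 0 < Real.Gamma ((q + 2) / 2) := Real.Gamma_pos_of_pos (by positivity)
  have hG2 : 0 < Real.Gamma ((q + d) / 2) := Real.Gamma_pos_of_pos (by positivity)
  rw [Aconst_zero hd, Aconst_eq hd hq.le, Real.rpow_add two_pos, Real.rpow_one]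
  rw [show ∀ a b : ℝ, a * 2 * b / 2 = a * b by intros; ring]
  rw [Real.mul_rpow (by positivity) (by positivity), ← Real.rpow_mul two_pos.le,
    mul_one_div_cancel hq.ne', Real.rpow_one]

theorem integrable_massiveG (hd : 1 ≤ d) :
    Integrable fun y : Euc d => massiveG d 1 (WithLp.ofLp y) := by
  simpa using integrable_norm_rpow_mul_massiveG hd (q := 0) le_rfl

/-- The law on `ℝ^d` with density proportional to the massive Green function of unit mass. -/
def greenLaw (d : ℕ) : Measure (Euc d) :=
  volume.withDensity fun y => ENNReal.ofReal (massiveG d 1 (WithLp.ofLp y) / 2)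

theorem measurable_massiveG :
    Measurable fun y : Euc d => massiveG d 1 (WithLp.ofLp y) := by
  simp_rw [massiveG_eq]
  exact (measurable_massInt.stronglyMeasurable.integral_prod_left'
    (μ := volume.restrict (Set.Ioi (0 : ℝ)))).measurable

theorem integral_greenLaw {F : Type*} [NormedAddCommGroup F] [NormedSpace ℝ F] (g : Euc d → F) :
    ∫ y, g y ∂greenLaw d = ∫ y : Euc d, (massiveG d 1 (WithLp.ofLp y) / 2) • g y := by
  unfold greenLaw
  rw [integral_withDensity_eq_integral_toReal_smul
    (measurable_massiveG.div_const 2).ennreal_ofReal (.of_forall fun _ => ENNReal.ofReal_lt_top)]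
  refine integral_congr_ae (.of_forall fun y => ?_)
  simp only
  rw [ENNReal.toReal_ofReal (div_nonneg (massiveG_nonneg _) two_pos.le)]

theorem isProbabilityMeasure_greenLaw (hd : 1 ≤ d) : IsProbabilityMeasure (greenLaw d) := by
  refine ⟨?_⟩
  unfold greenLaw
  rw [withDensity_apply _ MeasurableSet.univ, Measure.restrict_univ,
    ← ofReal_integral_eq_lintegral_ofReal ((integrable_massiveG hd).div_const 2)
      (.of_forall fun y => div_nonneg (massiveG_nonneg _) two_pos.le), integral_div]
  have := Aconst_eq_integral (d := d) 0
  simp only [Real.rpow_zero, one_mul] at this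
  rw [← this, Aconst_zero hd]; simp

theorem integral_norm_rpow_greenLaw (q : ℝ) :
    ∫ y, ‖y‖ ^ q ∂greenLaw d = Aconst d q / 2 := by
  rw [integral_greenLaw, Aconst_eq_integral, ← integral_div]
  refine integral_congr_ae (.of_forall fun y => ?_)
  simp only [smul_eq_mul]; ring

theorem integrable_norm_rpow_greenLaw (hd : 1 ≤ d) {q : ℝ} (hq : 0 ≤ q) :
    Integrable (fun y => ‖y‖ ^ q) (greenLaw d) := by
  unfold greenLaw
  rw [integrable_withDensity_iff (measurable_massiveG.div_const 2).ennreal_ofReal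
    (.of_forall fun _ => ENNReal.ofReal_lt_top)]
  refine ((integrable_norm_rpow_mul_massiveG hd hq).div_const 2).congr (.of_forall fun y => ?_)
  simp only
  rw [ENNReal.toReal_ofReal (div_nonneg (massiveG_nonneg _) two_pos.le)]; ring

theorem integral_gaussDens_mul_cexp {t : ℝ} (ht : 0 < t) (k : Euc d) :
    ∫ y : Euc d, (gaussDens d t y : ℂ) * Complex.exp (inner ℝ y k * Complex.I) =
      Complex.exp (-(t * ‖k‖ ^ 2 / 2)) := by
  have h := GaussianFourier.integral_cexp_neg_mul_sq_norm_add (V := Euc d)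
    (b := ((1 / (2 * t) : ℝ) : ℂ)) (by rw [Complex.ofReal_re]; positivity) Complex.I k
  have e : ∀ y : Euc d, (gaussDens d t y : ℂ) * Complex.exp (inner ℝ y k * Complex.I) =
      ((1 / (2 * π * t) ^ ((d : ℝ) / 2) : ℝ) : ℂ) *
        Complex.exp (-((1 / (2 * t) : ℝ) : ℂ) * ‖y‖ ^ 2 + Complex.I * inner ℝ k y) := by
    intro y
    rw [Complex.exp_add, gaussDens, Complex.ofReal_mul, Complex.ofReal_exp, real_inner_comm,
      mul_comm Complex.I, mul_assoc]
    congr 3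
    push_cast; ring
  simp_rw [e]
  rw [integral_const_mul, h]
  have hb : (π : ℂ) / ((1 / (2 * t) : ℝ) : ℂ) = ((2 * π * t : ℝ) : ℂ) := by
    push_cast; field_simp
  have h2 : (0 : ℝ) < 2 * π * t := by positivity
  rw [hb, finrank_euclideanSpace, Fintype.card_fin]
  have hc : ((2 * π * t : ℝ) : ℂ) ^ ((d : ℂ) / 2) = (((2 * π * t) ^ ((d : ℝ) / 2) : ℝ) : ℂ) := by
    rw [Complex.ofReal_cpow h2.le]; push_cast; rfl
  rw [hc, ← mul_assoc, ← Complex.ofReal_mul, one_div_mul_cancel (by positivity),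
    Complex.ofReal_one, one_mul]
  congr 1
  rw [Complex.I_sq]
  have : (t : ℂ) ≠ 0 := by exact_mod_cast ht.ne'
  push_cast; field_simp; ring

theorem charFun_greenLaw (hd : 1 ≤ d) (k : Euc d) :
    charFun (greenLaw d) k = ((1 / (1 + ‖k‖ ^ 2) : ℝ) : ℂ) := by
  rw [charFun_apply, integral_greenLaw]
  have e1 : ∀ y : Euc d, (massiveG d 1 (WithLp.ofLp y) / 2) •
      Complex.exp (inner ℝ y k * Complex.I) =
      ∫ t in Set.Ioi (0 : ℝ), (massInt d t y : ℂ) * Complex.exp (inner ℝ y k * Complex.I) / 2 := by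
    intro y
    rw [integral_div, integral_mul_const, integral_complex_ofReal, ← massiveG_eq,
      Complex.real_smul]
    push_cast; ring
  simp_rw [e1]
  have hint : Integrable (Function.uncurry fun (t : ℝ) (y : Euc d) =>
      (massInt d t y : ℂ) * Complex.exp (inner ℝ y k * Complex.I) / 2)
      ((volume.restrict (Set.Ioi (0 : ℝ))).prod volume) := by
    have h0 := integrable_norm_rpow_mul_massInt hd (q := 0) le_rfl
    refine h0.mono ?_ (.of_forall fun p => ?_)
    · refine Measurable.aestronglyMeasurable ?_
      have := measurable_massInt (d := d)
      simp only [Function.uncurry_def]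
      fun_prop
    · simp only [Function.uncurry, norm_div, norm_mul, Complex.norm_exp_ofReal_mul_I,
        Real.rpow_zero, one_mul, mul_one, Complex.norm_real, RCLike.norm_ofNat]
      exact half_le_self (norm_nonneg _)
  rw [← integral_integral_swap hint]
  have e2 : ∀ t ∈ Set.Ioi (0 : ℝ), ∫ y : Euc d, (massInt d t y : ℂ) *
      Complex.exp (inner ℝ y k * Complex.I) / 2 =
      ((Real.exp (-((1 + ‖k‖ ^ 2) / 2) * t) / 2 : ℝ) : ℂ) := by
    intro t ht
    have : ∀ y : Euc d, (massInt d t y : ℂ) * Complex.exp (inner ℝ y k * Complex.I) / 2 =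
      (Real.exp (-t / 2) / 2 : ℝ) *
        ((gaussDens d t y : ℂ) * Complex.exp (inner ℝ y k * Complex.I)) := by
      intro y; unfold massInt; push_cast; ring
    simp_rw [this]
    rw [integral_const_mul, integral_gaussDens_mul_cexp ht,
      show -((t : ℂ) * ‖k‖ ^ 2 / 2) = ((-(t * ‖k‖ ^ 2 / 2) : ℝ) : ℂ) by push_cast; ring,
      ← Complex.ofReal_exp, ← Complex.ofReal_mul]
    congr 1
    rw [div_mul_eq_mul_div, ← Real.exp_add]
    congr 2; ring
  rw [setIntegral_congr_fun measurableSet_Ioi e2, integral_complex_ofReal, integral_div]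
  congr 1
  have hk : 0 < (1 + ‖k‖ ^ 2) / 2 := by positivity
  have := integral_exp_mul_Ioi (a := -((1 + ‖k‖ ^ 2) / 2)) (by linarith) 0
  rw [this]
  simp; field_simp

/-- Bilinear pairing of a complex vector with a lattice point. -/
def cdot (w : Fin d → ℂ) (x : Fin d → ℤ) : ℂ := ∑ i, w i * (x i : ℂ)

/-- Complex-tilted sum `∑ f(x) e^{w·x}`. -/
def laplace (f : (Fin d → ℤ) → ℝ) (w : Fin d → ℂ) : ℂ := ∑' x, (f x : ℂ) * Complex.exp (cdot w x)

/-- Coordinatewise real part. -/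
def reVec (w : Fin d → ℂ) : Fin d → ℝ := fun i => (w i).re

theorem cdot_re (w : Fin d → ℂ) (x : Fin d → ℤ) : (cdot w x).re = rdotZ (reVec w) x := by
  simp [cdot, rdotZ, reVec]

theorem cdot_sub (w : Fin d → ℂ) (x y : Fin d → ℤ) : cdot w (x - y) = cdot w x - cdot w y := by
  simp [cdot, mul_sub]

theorem norm_laplace_term (f : (Fin d → ℤ) → ℝ) (w : Fin d → ℂ) (x : Fin d → ℤ) :
    ‖(f x : ℂ) * Complex.exp (cdot w x)‖ = |f x| * Real.exp (rdotZ (reVec w) x) := by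
  rw [norm_mul, Complex.norm_exp, cdot_re, Complex.norm_real, Real.norm_eq_abs]

/-- The exponentially weighted absolute summability of a lattice function. -/
def ExpSummable (f : (Fin d → ℤ) → ℝ) (μ : Fin d → ℝ) : Prop :=
  Summable fun x => |f x| * Real.exp (rdotZ μ x)

theorem ExpSummable.summable_norm {f : (Fin d → ℤ) → ℝ} {w : Fin d → ℂ}
    (hf : ExpSummable f (reVec w)) : Summable fun x => ‖(f x : ℂ) * Complex.exp (cdot w x)‖ := by
  simp only [norm_laplace_term]
  exact hf

theorem laplace_eq_of_conv {S J h : (Fin d → ℤ) → ℝ} {w : Fin d → ℂ}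
    (hOZ : ∀ x, S x = h x + conv J S x) (hS : ExpSummable S (reVec w))
    (hJ : ExpSummable J (reVec w)) (hh : ExpSummable h (reVec w)) :
    laplace S w * (1 - laplace J w) = laplace h w := by
  let a : (Fin d → ℤ) → ℂ := fun x => (J x : ℂ) * Complex.exp (cdot w x)
  let b : (Fin d → ℤ) → ℂ := fun x => (S x : ℂ) * Complex.exp (cdot w x)
  let e : (Fin d → ℤ) × (Fin d → ℤ) ≃ (Fin d → ℤ) × (Fin d → ℤ) :=
    ⟨fun p => (p.1 - p.2, p.2), fun p => (p.1 + p.2, p.2), fun p => by simp, fun p => by simp⟩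
  have hab : Summable fun p : (Fin d → ℤ) × (Fin d → ℤ) => a p.1 * b p.2 :=
    summable_mul_of_summable_norm hJ.summable_norm hS.summable_norm
  have habe : Summable fun p : (Fin d → ℤ) × (Fin d → ℤ) => a (p.1 - p.2) * b p.2 :=
    e.summable_iff.2 hab
  have hterm : ∀ x, ((conv J S x : ℝ) : ℂ) * Complex.exp (cdot w x) = ∑' y, a (x - y) * b y := by
    intro x
    rw [conv, Complex.ofReal_tsum, ← tsum_mul_right]
    refine tsum_congr fun y => ?_
    simp only [a, b, cdot_sub]
    rw [show Complex.exp (cdot w x) = Complex.exp (cdot w x - cdot w y) * Complex.exp (cdot w y) by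
      rw [← Complex.exp_add]; ring_nf]
    push_cast; ring
  have hprod : laplace J w * laplace S w = ∑' x, ((conv J S x : ℝ) : ℂ) * Complex.exp (cdot w x) := by
    simp_rw [hterm]
    rw [laplace, laplace, tsum_mul_tsum_of_summable_norm hJ.summable_norm hS.summable_norm,
      ← e.tsum_eq]
    exact habe.tsum_prod
  have hcs : Summable fun x => ((conv J S x : ℝ) : ℂ) * Complex.exp (cdot w x) := by
    simp_rw [hterm]; exact habe.prod
  have : laplace S w = laplace h w + laplace J w * laplace S w := by
    rw [hprod, laplace, laplace, ← hh.summable_norm.of_norm.tsum_add hcs]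
    refine tsum_congr fun x => ?_
    rw [← add_mul, ← Complex.ofReal_add, ← hOZ x]
  linear_combination this

theorem norm_cexp_sub_one_le {p : ℝ} (hp0 : 0 ≤ p) (hp1 : p ≤ 1) (w : ℂ) :
    ‖Complex.exp w - 1‖ ≤ 2 * ‖w‖ ^ p * (1 + Real.exp w.re) := by
  have hexp := Real.exp_pos w.re
  rcases le_or_gt ‖w‖ 1 with h | h
  · have h1 : ‖w‖ ≤ ‖w‖ ^ p := by
      rcases (norm_nonneg w).eq_or_lt with h0 | h0
      · rw [← h0]; positivity
      · simpa using Real.rpow_le_rpow_of_exponent_ge h0 h hp1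
    have h2 := Complex.norm_exp_sub_one_le h
    nlinarith [Real.rpow_nonneg (norm_nonneg w) p]
  · have h1 : 1 ≤ ‖w‖ ^ p := Real.one_le_rpow h.le hp0
    have h2 : ‖Complex.exp w - 1‖ ≤ Real.exp w.re + 1 := by
      simpa [Complex.norm_exp] using norm_sub_le (Complex.exp w) 1
    nlinarith

theorem norm_cexp_sub_quadratic_le {p : ℝ} (hp0 : 0 ≤ p) (hp1 : p ≤ 1) (w : ℂ) :
    ‖Complex.exp w - 1 - w - w ^ 2 / 2‖ ≤ 3 * ‖w‖ ^ (2 + p) * (1 + Real.exp w.re) := by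
  have hexp := Real.exp_pos w.re
  have hrn := Real.rpow_nonneg (norm_nonneg w) (2 + p)
  rcases le_or_gt ‖w‖ 1 with h | h
  · have h1 : ‖w‖ ^ 3 ≤ ‖w‖ ^ (2 + p) := by
      rcases (norm_nonneg w).eq_or_lt with h0 | h0
      · rw [← h0]; simp; positivity
      · have := Real.rpow_le_rpow_of_exponent_ge h0 h (show 2 + p ≤ (3 : ℕ) by norm_num; linarith)
        rwa [Real.rpow_natCast] at this
    have h2 := Complex.exp_bound h (n := 3) (by norm_num)
    simp only [Finset.sum_range_succ, Finset.sum_range_zero] at h2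
    norm_num at h2
    have e : Complex.exp w - 1 - w - w ^ 2 / 2 = Complex.exp w - (1 + w + w ^ 2 / 2) := by ring
    rw [e]
    nlinarith [pow_nonneg (norm_nonneg w) 3]
  · have h1 : ‖w‖ ^ 2 ≤ ‖w‖ ^ (2 + p) := by
      have := Real.rpow_le_rpow_of_exponent_le h.le (show ((2 : ℕ) : ℝ) ≤ 2 + p by norm_num; linarith)
      rwa [Real.rpow_natCast] at this
    have h2 : ‖Complex.exp w - 1 - w - w ^ 2 / 2‖ ≤ Real.exp w.re + 1 + ‖w‖ + ‖w‖ ^ 2 / 2 := by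
      refine (norm_sub_le _ _).trans (add_le_add ((norm_sub_le _ _).trans (add_le_add
        ((norm_sub_le _ _).trans (add_le_add (Complex.norm_exp _).le (by simp))) le_rfl)) ?_)
      simp
    have h3 : ‖w‖ ≤ ‖w‖ ^ 2 := by nlinarith
    have h4 : 1 ≤ ‖w‖ ^ (2 + p) := by linarith
    nlinarith [mul_le_mul_of_nonneg_right h4 hexp.le]

theorem enormZ_nonneg (x : Fin d → ℤ) : 0 ≤ enormZ x := Real.sqrt_nonneg _

theorem abs_coord_le_enormZ (x : Fin d → ℤ) (i : Fin d) : |(x i : ℝ)| ≤ enormZ x := by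
  rw [← Real.sqrt_sq_eq_abs]
  exact Real.sqrt_le_sqrt (Finset.single_le_sum (f := fun i => ((x i : ℝ)) ^ 2)
    (fun _ _ => sq_nonneg _) (Finset.mem_univ i))

theorem one_le_enormZ_or (x : Fin d → ℤ) : enormZ x = 0 ∨ 1 ≤ enormZ x := by
  by_cases h : x = 0
  · left; simp [h, enormZ]
  · right
    obtain ⟨i, hi⟩ := Function.ne_iff.1 h
    refine le_trans ?_ (abs_coord_le_enormZ x i)
    rw [← Int.cast_abs]
    exact_mod_cast Int.one_le_abs hi

theorem enormZ_rpow_le (x : Fin d → ℤ) {a b : ℝ} (ha : 0 < a) (hab : a ≤ b) :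
    enormZ x ^ a ≤ enormZ x ^ b := by
  rcases one_le_enormZ_or x with h | h
  · rw [h, Real.zero_rpow ha.ne', Real.zero_rpow (ha.trans_le hab).ne']
  · exact Real.rpow_le_rpow_of_exponent_le h hab

theorem norm_cdot_le (w : Fin d → ℂ) (x : Fin d → ℤ) :
    ‖cdot w x‖ ≤ (∑ i, ‖w i‖) * enormZ x := by
  unfold cdot
  rw [Finset.sum_mul]
  refine norm_sum_le_of_le _ fun i _ => ?_
  rw [norm_mul]
  gcongr
  simpa using abs_coord_le_enormZ x i

theorem summable_of_lpNorm_one_le {f : (Fin d → ℤ) → ℝ} {M : ℝ} (hM : 0 ≤ M)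
    (h : lpNorm f 1 ≤ ENNReal.ofReal M) : Summable (fun x => |f x|) ∧ ∑' x, |f x| ≤ M := by
  simp only [lpNorm, Real.rpow_one, div_one, ENNReal.rpow_one] at h
  have hs : Summable fun x => |f x| := by
    have := ENNReal.summable_toReal (ne_top_of_le_ne_top ENNReal.ofReal_ne_top h)
    simpa using this
  refine ⟨hs, ?_⟩
  rw [← ENNReal.ofReal_tsum_of_nonneg (fun _ => abs_nonneg _) hs] at h
  exact (ENNReal.ofReal_le_ofReal_iff hM).1 h

/-- Sign flips of lattice coordinates, as a permutation of the lattice. -/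
def flipPerm (ε : Fin d → Bool) : Equiv.Perm (Fin d → ℤ) :=
  Function.Involutive.toPerm (fun x i => if ε i then -(x i) else x i) fun x => by
    ext i; by_cases h : ε i <;> simp [h]

/-- The transposition of two lattice coordinates, as a permutation of the lattice. -/
def swapPerm (i j : Fin d) : Equiv.Perm (Fin d → ℤ) :=
  Function.Involutive.toPerm (fun x k => x (Equiv.swap i j k)) fun x => by
    ext k; simp

theorem flipPerm_apply (ε : Fin d → Bool) (x : Fin d → ℤ) (i : Fin d) :
    flipPerm ε x i = if ε i then -(x i) else x i := rfl

theorem swapPerm_apply (i j : Fin d) (x : Fin d → ℤ) (k : Fin d) :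
    swapPerm i j x k = x (Equiv.swap i j k) := rfl

theorem tsum_flip {f : (Fin d → ℤ) → ℝ} (hf : ZdSymmetric f) (ε : Fin d → Bool)
    (g : (Fin d → ℤ) → ℝ) : ∑' x, f x * g (flipPerm ε x) = ∑' x, f x * g x := by
  rw [← (flipPerm ε).tsum_eq (fun x => f x * g x)]
  exact tsum_congr fun x => by rw [show f (flipPerm ε x) = f x from hf.2 ε x]

theorem tsum_swap {f : (Fin d → ℤ) → ℝ} (hf : ZdSymmetric f) (i j : Fin d)
    (g : (Fin d → ℤ) → ℝ) : ∑' x, f x * g (swapPerm i j x) = ∑' x, f x * g x := by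
  rw [← (swapPerm i j).tsum_eq (fun x => f x * g x)]
  exact tsum_congr fun x => by rw [show f (swapPerm i j x) = f x from hf.1 _ x]

theorem summable_flip {f : (Fin d → ℤ) → ℝ} (hf : ZdSymmetric f) (ε : Fin d → Bool)
    (g : (Fin d → ℤ) → ℝ) :
    (Summable fun x => f x * g (flipPerm ε x)) ↔ Summable fun x => f x * g x := by
  rw [← (flipPerm ε).summable_iff (f := fun x => f x * g x)]
  exact summable_congr fun x => by
    simp only [Function.comp]; rw [show f (flipPerm ε x) = f x from hf.2 ε x]

theorem summable_swap {f : (Fin d → ℤ) → ℝ} (hf : ZdSymmetric f) (i j : Fin d)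
    (g : (Fin d → ℤ) → ℝ) :
    (Summable fun x => f x * g (swapPerm i j x)) ↔ Summable fun x => f x * g x := by
  rw [← (swapPerm i j).summable_iff (f := fun x => f x * g x)]
  exact summable_congr fun x => by
    simp only [Function.comp]; rw [show f (swapPerm i j x) = f x from hf.1 _ x]

theorem tsum_coord_eq_zero {f : (Fin d → ℤ) → ℝ} (hf : ZdSymmetric f) (i : Fin d) :
    ∑' x, f x * (x i : ℝ) = 0 := by
  have h := tsum_flip hf (fun _ => true) fun x => (x i : ℝ)
  simp only [flipPerm_apply, if_true, Int.cast_neg, mul_neg, tsum_neg] at h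
  linarith

theorem tsum_coord_mul_coord_eq_zero {f : (Fin d → ℤ) → ℝ} (hf : ZdSymmetric f) {i j : Fin d}
    (hij : i ≠ j) : ∑' x, f x * ((x i : ℝ) * x j) = 0 := by
  have h := tsum_flip hf (fun k => decide (k = i)) fun x => (x i : ℝ) * x j
  simp only [flipPerm_apply, decide_true, if_true, hij.symm,
    decide_false, Int.cast_neg, neg_mul, mul_neg, tsum_neg, Bool.false_eq_true, if_false] at h
  linarith

theorem tsum_coord_sq {f : (Fin d → ℤ) → ℝ} (hd : 1 ≤ d) (hf : ZdSymmetric f)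
    (hs : ∀ i, Summable fun x => f x * ((x i : ℝ) * x i)) (i : Fin d) :
    ∑' x, f x * ((x i : ℝ) * x i) = sigmaSq f / d := by
  have h : ∀ j, ∑' x, f x * ((x j : ℝ) * x j) = ∑' x, f x * ((x i : ℝ) * x i) := fun j => by
    have := tsum_swap hf i j fun x => (x i : ℝ) * x i
    simpa [swapPerm_apply] using this
  have h2 : sigmaSq f = ∑ j, ∑' x, f x * ((x j : ℝ) * x j) := by
    rw [← Summable.tsum_finsetSum fun j _ => hs j]
    refine tsum_congr fun x => ?_
    rw [enormZ, Real.sq_sqrt (Finset.sum_nonneg fun _ _ => sq_nonneg _), Finset.sum_mul]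
    exact Finset.sum_congr rfl fun j _ => by ring
  have hd' : (0 : ℝ) < d := by exact_mod_cast hd
  rw [h2, Finset.sum_congr rfl fun j _ => h j]
  simp; field_simp

section

variable {S J h : (Fin d → ℤ) → ℝ} {M K ζ : ℝ}

theorem weighted_of_lpNorm {f v : (Fin d → ℤ) → ℝ} {μ : Fin d → ℝ} (hv : ∀ y, 0 ≤ v y)
    (hM : 0 ≤ M) (hl : lpNorm (fun y => v y * tilt f μ y) 1 ≤ ENNReal.ofReal M) :
    Summable (fun y => v y * (|f y| * Real.exp (rdotZ μ y))) ∧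
      ∑' y, v y * (|f y| * Real.exp (rdotZ μ y)) ≤ M := by
  have e : ∀ y, |v y * tilt f μ y| = v y * (|f y| * Real.exp (rdotZ μ y)) := fun y => by
    rw [tilt, abs_mul, abs_mul, Real.abs_exp, abs_of_nonneg (hv y)]
  have := summable_of_lpNorm_one_le hM hl
  simpa only [e] using this

theorem weighted_mono {f : (Fin d → ℤ) → ℝ} {μ : Fin d → ℝ} {a b : ℝ} (ha : 0 < a) (hab : a ≤ b)
    (hM : 0 ≤ M) (hl : lpNorm (fun y => enormZ y ^ b * tilt f μ y) 1 ≤ ENNReal.ofReal M) :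
    Summable (fun y => enormZ y ^ a * (|f y| * Real.exp (rdotZ μ y))) ∧
      ∑' y, enormZ y ^ a * (|f y| * Real.exp (rdotZ μ y)) ≤ M := by
  obtain ⟨h1, h2⟩ := weighted_of_lpNorm (v := fun y => enormZ y ^ b)
    (fun y => Real.rpow_nonneg (enormZ_nonneg y) _) hM hl
  have hle : ∀ y, enormZ y ^ a * (|f y| * Real.exp (rdotZ μ y)) ≤
      enormZ y ^ b * (|f y| * Real.exp (rdotZ μ y)) := fun y =>
    mul_le_mul_of_nonneg_right (enormZ_rpow_le y ha hab) (by positivity)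
  have hs : Summable (fun y => enormZ y ^ a * (|f y| * Real.exp (rdotZ μ y))) :=
    h1.of_nonneg_of_le (fun y => mul_nonneg (Real.rpow_nonneg (enormZ_nonneg y) _)
      (by positivity)) hle
  exact ⟨hs, (hs.tsum_le_tsum hle h1).trans h2⟩

theorem AssumptionJ.exp_J (hJ : AssumptionJ S J h M K ζ) {μ : Fin d → ℝ}
    (hμ : μ ∈ closure (Omega S)) :
    ExpSummable J μ ∧ ∑' y, |J y| * Real.exp (rdotZ μ y) ≤ M := by
  have := weighted_of_lpNorm (f := J) (v := fun _ => 1) (fun _ => zero_le_one) hJ.M_pos.le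
    (by simpa only [one_mul] using (hJ.memQ μ hμ).Q_l1)
  simp only [one_mul] at this
  exact this

theorem AssumptionJ.exp_h (hJ : AssumptionJ S J h M K ζ) {μ : Fin d → ℝ}
    (hμ : μ ∈ closure (Omega S)) :
    ExpSummable h μ ∧ ∑' y, |h y| * Real.exp (rdotZ μ y) ≤ M := by
  have := weighted_of_lpNorm (f := h) (v := fun _ => 1) (fun _ => zero_le_one) hJ.M_pos.le
    (by simpa only [one_mul] using (hJ.memQ μ hμ).g_l1)
  simp only [one_mul] at this
  exact this

theorem AssumptionJ.moment_J (hJ : AssumptionJ S J h M K ζ) {μ : Fin d → ℝ}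
    (hμ : μ ∈ closure (Omega S)) {a : ℝ} (ha : 0 < a) (haζ : a ≤ 2 + ζ) :
    Summable (fun y => enormZ y ^ a * (|J y| * Real.exp (rdotZ μ y))) ∧
      ∑' y, enormZ y ^ a * (|J y| * Real.exp (rdotZ μ y)) ≤ M :=
  weighted_mono ha haζ hJ.M_pos.le (hJ.memQ μ hμ).Q_moment

theorem AssumptionJ.moment_h (hJ : AssumptionJ S J h M K ζ) {μ : Fin d → ℝ}
    (hμ : μ ∈ closure (Omega S)) {a : ℝ} (ha : 0 < a) (haζ : a ≤ ζ) :
    Summable (fun y => enormZ y ^ a * (|h y| * Real.exp (rdotZ μ y))) ∧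
      ∑' y, enormZ y ^ a * (|h y| * Real.exp (rdotZ μ y)) ≤ M :=
  weighted_mono ha haζ hJ.M_pos.le (hJ.memQ μ hμ).g_zeta

theorem rdotZ_zero (y : Fin d → ℤ) : rdotZ 0 y = 0 := by simp [rdotZ]

theorem reVec_zero : reVec (0 : Fin d → ℂ) = 0 := by ext; simp [reVec]

theorem AssumptionJ.summable_coord (hJ : AssumptionJ S J h M K ζ)
    (h0 : (0 : Fin d → ℝ) ∈ closure (Omega S)) (i : Fin d) :
    Summable fun x => J x * (x i : ℝ) := by
  have := (hJ.moment_J h0 one_pos (by linarith [hJ.zeta_pos])).1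
  refine Summable.of_norm_bounded this fun x => ?_
  rw [norm_mul, Real.norm_eq_abs, Real.norm_eq_abs, rdotZ_zero, Real.exp_zero, Real.rpow_one,
    mul_one, mul_comm]
  exact mul_le_mul_of_nonneg_right (abs_coord_le_enormZ x i) (abs_nonneg _)

theorem AssumptionJ.summable_coord_mul_coord (hJ : AssumptionJ S J h M K ζ)
    (h0 : (0 : Fin d → ℝ) ∈ closure (Omega S)) (i j : Fin d) :
    Summable fun x => J x * ((x i : ℝ) * x j) := by
  have := (hJ.moment_J h0 two_pos (by linarith [hJ.zeta_pos])).1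
  refine Summable.of_norm_bounded this fun x => ?_
  rw [norm_mul, norm_mul, Real.norm_eq_abs, Real.norm_eq_abs, Real.norm_eq_abs, rdotZ_zero,
    Real.exp_zero, Real.rpow_two, mul_one, mul_comm, sq]
  have := enormZ_nonneg x
  gcongr <;> exact abs_coord_le_enormZ x _

theorem AssumptionJ.hasSum_cdot (hJ : AssumptionJ S J h M K ζ)
    (h0 : (0 : Fin d → ℝ) ∈ closure (Omega S)) (w : Fin d → ℂ) :
    HasSum (fun x => (J x : ℂ) * cdot w x) 0 := by
  have h1 : ∀ i : Fin d, HasSum (fun x => w i * ((J x * (x i : ℝ) : ℝ) : ℂ)) (w i * (0 : ℝ)) :=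
    fun i => (Complex.hasSum_ofReal.2
      (tsum_coord_eq_zero hJ.J_symm i ▸ (hJ.summable_coord h0 i).hasSum)).mul_left _
  have h2 := hasSum_sum fun i (_ : i ∈ Finset.univ) => h1 i
  simp only [Complex.ofReal_zero, mul_zero, Finset.sum_const_zero] at h2
  refine h2.congr_fun fun x => ?_
  rw [cdot, Finset.mul_sum]
  exact Finset.sum_congr rfl fun i _ => by push_cast; ring

theorem AssumptionJ.hasSum_cdot_sq (hd : 1 ≤ d) (hJ : AssumptionJ S J h M K ζ)
    (h0 : (0 : Fin d → ℝ) ∈ closure (Omega S)) (w : Fin d → ℂ) :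
    HasSum (fun x => (J x : ℂ) * cdot w x ^ 2) ((∑ i, w i ^ 2) * ((sigmaSq J / d : ℝ) : ℂ)) := by
  have h1 : ∀ i j : Fin d, HasSum (fun x => w i * w j * ((J x * ((x i : ℝ) * x j) : ℝ) : ℂ))
      (w i * w j * ((if i = j then sigmaSq J / d else 0 : ℝ) : ℂ)) := fun i j => by
    refine (Complex.hasSum_ofReal.2 ?_).mul_left _
    have hs := (hJ.summable_coord_mul_coord h0 i j).hasSum
    split_ifs with hij
    · subst hij
      rwa [tsum_coord_sq hd hJ.J_symm (fun i => hJ.summable_coord_mul_coord h0 i i)] at hs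
    · rwa [tsum_coord_mul_coord_eq_zero hJ.J_symm hij] at hs
  have h2 := hasSum_sum fun i (_ : i ∈ Finset.univ) =>
    hasSum_sum fun j (_ : j ∈ Finset.univ) => h1 i j
  convert h2 using 1
  · ext x
    rw [cdot, sq, Finset.sum_mul_sum, Finset.mul_sum]
    refine Finset.sum_congr rfl fun i _ => ?_
    rw [Finset.mul_sum]
    exact Finset.sum_congr rfl fun j _ => by push_cast; ring
  · rw [Finset.sum_mul]
    refine Finset.sum_congr rfl fun i _ => ?_
    rw [Finset.sum_eq_single i (fun j _ hj => by simp [hj.symm]) (by simp)]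
    simp [sq]

theorem ExpSummable.hasSum_laplace {f : (Fin d → ℤ) → ℝ} {w : Fin d → ℂ}
    (hf : ExpSummable f (reVec w)) :
    HasSum (fun x => (f x : ℂ) * Complex.exp (cdot w x)) (laplace f w) :=
  hf.summable_norm.of_norm.hasSum

theorem ExpSummable.hasSum_laplace_zero {f : (Fin d → ℤ) → ℝ} (hf : ExpSummable f 0) :
    HasSum (fun x => (f x : ℂ)) (laplace f 0) := by
  have := ExpSummable.hasSum_laplace (w := 0) (f := f) (by rwa [reVec_zero])
  simpa [cdot] using this

theorem AssumptionJ.laplace_J_expansion (hd : 1 ≤ d) (hJ : AssumptionJ S J h M K ζ)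
    (h0 : (0 : Fin d → ℝ) ∈ closure (Omega S)) {w : Fin d → ℂ}
    (hw : reVec w ∈ closure (Omega S)) {p : ℝ} (hp0 : 0 < p) (hp1 : p ≤ 1) (hpζ : p ≤ ζ) :
    ‖laplace J w - laplace J 0 - (∑ i, w i ^ 2) * ((sigmaSq J / d : ℝ) : ℂ) / 2‖ ≤
      6 * M * (∑ i, ‖w i‖) ^ (2 + p) := by
  have hsum := (((hJ.exp_J hw).1.hasSum_laplace.sub (hJ.exp_J h0).1.hasSum_laplace_zero).sub
    (hJ.hasSum_cdot h0 w)).sub ((hJ.hasSum_cdot_sq hd h0 w).div_const 2)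
  rw [sub_zero] at hsum
  obtain ⟨s1, l1⟩ := hJ.moment_J h0 (a := 2 + p) (by linarith) (by linarith)
  obtain ⟨s2, l2⟩ := hJ.moment_J hw (a := 2 + p) (by linarith) (by linarith)
  have hW : 0 ≤ ∑ i, ‖w i‖ := Finset.sum_nonneg fun _ _ => norm_nonneg _
  refine (hsum.norm_le_of_bounded
    ((s1.hasSum.add s2.hasSum).mul_left (3 * (∑ i, ‖w i‖) ^ (2 + p))) fun x => ?_).trans ?_
  · have e : (J x : ℂ) * Complex.exp (cdot w x) - J x - J x * cdot w x - J x * cdot w x ^ 2 / 2 =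
        J x * (Complex.exp (cdot w x) - 1 - cdot w x - cdot w x ^ 2 / 2) := by ring
    rw [e, norm_mul, Complex.norm_real, Real.norm_eq_abs, rdotZ_zero, Real.exp_zero]
    have h1 := norm_cexp_sub_quadratic_le hp0.le hp1 (cdot w x)
    have h2 : ‖cdot w x‖ ^ (2 + p) ≤ (∑ i, ‖w i‖) ^ (2 + p) * enormZ x ^ (2 + p) := by
      rw [← Real.mul_rpow hW (enormZ_nonneg x)]
      exact Real.rpow_le_rpow (norm_nonneg _) (norm_cdot_le w x) (by linarith)
    rw [cdot_re] at h1
    have hE := Real.exp_pos (rdotZ (reVec w) x)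
    calc _ ≤ |J x| * (3 * ((∑ i, ‖w i‖) ^ (2 + p) * enormZ x ^ (2 + p)) *
          (1 + Real.exp (rdotZ (reVec w) x))) := by
          refine mul_le_mul_of_nonneg_left (h1.trans ?_) (abs_nonneg _)
          gcongr
      _ = _ := by ring
  · have : 0 ≤ (∑ i, ‖w i‖) ^ (2 + p) := Real.rpow_nonneg hW _
    nlinarith

theorem AssumptionJ.laplace_h_sub (hJ : AssumptionJ S J h M K ζ)
    (h0 : (0 : Fin d → ℝ) ∈ closure (Omega S)) {w : Fin d → ℂ}
    (hw : reVec w ∈ closure (Omega S)) {p : ℝ} (hp0 : 0 < p) (hp1 : p ≤ 1) (hpζ : p ≤ ζ) :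
    ‖laplace h w - laplace h 0‖ ≤ 4 * M * (∑ i, ‖w i‖) ^ p := by
  have hsum := (hJ.exp_h hw).1.hasSum_laplace.sub (hJ.exp_h h0).1.hasSum_laplace_zero
  obtain ⟨s1, l1⟩ := hJ.moment_h h0 hp0 hpζ
  obtain ⟨s2, l2⟩ := hJ.moment_h hw hp0 hpζ
  have hW : 0 ≤ ∑ i, ‖w i‖ := Finset.sum_nonneg fun _ _ => norm_nonneg _
  refine (hsum.norm_le_of_bounded
    ((s1.hasSum.add s2.hasSum).mul_left (2 * (∑ i, ‖w i‖) ^ p)) fun x => ?_).trans ?_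
  · have e : (h x : ℂ) * Complex.exp (cdot w x) - h x = h x * (Complex.exp (cdot w x) - 1) := by
      ring
    rw [e, norm_mul, Complex.norm_real, Real.norm_eq_abs, rdotZ_zero, Real.exp_zero]
    have h1 := norm_cexp_sub_one_le hp0.le hp1 (cdot w x)
    have h2 : ‖cdot w x‖ ^ p ≤ (∑ i, ‖w i‖) ^ p * enormZ x ^ p := by
      rw [← Real.mul_rpow hW (enormZ_nonneg x)]
      exact Real.rpow_le_rpow (norm_nonneg _) (norm_cdot_le w x) hp0.le
    rw [cdot_re] at h1
    have hE := Real.exp_pos (rdotZ (reVec w) x)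
    calc _ ≤ |h x| * (2 * ((∑ i, ‖w i‖) ^ p * enormZ x ^ p) *
          (1 + Real.exp (rdotZ (reVec w) x))) := by
          refine mul_le_mul_of_nonneg_left (h1.trans ?_) (abs_nonneg _)
          gcongr
      _ = _ := by ring
  · have : 0 ≤ (∑ i, ‖w i‖) ^ p := Real.rpow_nonneg hW _
    nlinarith

end

theorem rdotZ_e1R (hd : 1 ≤ d) (t : ℝ) (x : Fin d → ℤ) :
    rdotZ (e1R d t) x = t * (x ⟨0, hd⟩ : ℝ) := by
  rw [rdotZ, Finset.sum_eq_single (⟨0, hd⟩ : Fin d)]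
  · simp [e1R]
  · intro i _ hi
    have : (i : ℕ) ≠ 0 := fun h => hi (Fin.ext h)
    simp [e1R, this]
  · simp

theorem continuous_e1R : Continuous (e1R d) := by
  refine continuous_pi fun i => ?_
  by_cases h : (i : ℕ) = 0
  · simpa [e1R, h] using continuous_id'
  · simpa [e1R, h] using continuous_const

theorem e1R_zero : e1R d 0 = 0 := by ext; simp [e1R]

/-- Coordinatewise embedding of a real vector into complex vectors. -/
def ofRealVec (μ : Fin d → ℝ) : Fin d → ℂ := fun i => (μ i : ℂ)

theorem reVec_ofRealVec (μ : Fin d → ℝ) : reVec (ofRealVec μ) = μ := by ext; simp [reVec, ofRealVec]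

theorem cdot_ofRealVec (μ : Fin d → ℝ) (x : Fin d → ℤ) : cdot (ofRealVec μ) x = rdotZ μ x := by
  simp [cdot, ofRealVec, rdotZ]

theorem laplace_ofRealVec (f : (Fin d → ℤ) → ℝ) (μ : Fin d → ℝ) :
    laplace f (ofRealVec μ) = (tiltSum f μ : ℂ) := by
  rw [laplace, tiltSum, Complex.ofReal_tsum]
  exact tsum_congr fun x => by rw [cdot_ofRealVec]; push_cast; rfl

theorem mem_Omega_iff {S : (Fin d → ℤ) → ℝ} (hS : ∀ x, 0 ≤ S x) (μ : Fin d → ℝ) :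
    μ ∈ Omega S ↔ ExpSummable S μ := by
  have e : ∀ x, |S x| * Real.exp (rdotZ μ x) = S x * Real.exp (rdotZ μ x) := fun x => by
    rw [abs_of_nonneg (hS x)]
  have hn : ∀ x, 0 ≤ S x * Real.exp (rdotZ μ x) := fun x => mul_nonneg (hS x) (Real.exp_pos _).le
  unfold ExpSummable
  simp only [e, Omega, Set.mem_ofPred_eq, chi]
  constructor
  · intro h
    have := ENNReal.summable_toReal h.ne
    simpa [ENNReal.toReal_ofReal (hn _)] using this
  · intro h
    rw [← ENNReal.ofReal_tsum_of_nonneg hn h]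
    exact ENNReal.ofReal_lt_top

theorem exp_le_one_add_exp {s t : ℝ} (hs : 0 ≤ s) (hst : s ≤ t) (y : ℝ) :
    Real.exp (s * y) ≤ 1 + Real.exp (t * y) := by
  rcases le_total 0 y with h | h
  · have := Real.exp_le_exp.2 (mul_le_mul_of_nonneg_right hst h); linarith
  · have := Real.exp_le_one_iff.2 (mul_nonpos_of_nonneg_of_nonpos hs h)
    linarith [Real.exp_pos (t * y)]

theorem ExpSummable.e1R_mono {f : (Fin d → ℤ) → ℝ} (hd : 1 ≤ d) (h0 : ExpSummable f 0) {s t : ℝ}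
    (ht : ExpSummable f (e1R d t)) (hs : 0 ≤ s) (hst : s ≤ t) : ExpSummable f (e1R d s) := by
  refine (Summable.add h0 ht).of_nonneg_of_le (fun x => by positivity) fun x => ?_
  rw [rdotZ_e1R hd, rdotZ_e1R hd, rdotZ_zero, Real.exp_zero, ← mul_add]
  exact mul_le_mul_of_nonneg_left (exp_le_one_add_exp hs hst _) (abs_nonneg _)

section

variable {S J h : (Fin d → ℤ) → ℝ} {M K ζ : ℝ}

theorem AssumptionOmega.expSummable (hS : AssumptionOmega S) {μ : Fin d → ℝ} (hμ : μ ∈ Omega S) :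
    ExpSummable S μ := (mem_Omega_iff hS.nonneg μ).1 hμ

theorem AssumptionOmega.e1R_mem_of_le (hS : AssumptionOmega S) (hd : 1 ≤ d) {s t : ℝ}
    (ht : e1R d t ∈ Omega S) (hs : 0 ≤ s) (hst : s ≤ t) : e1R d s ∈ Omega S :=
  (mem_Omega_iff hS.nonneg _).2
    ((hS.expSummable hS.zero_mem).e1R_mono hd (hS.expSummable ht) hs hst)

theorem AssumptionOmega.bddAbove (hS : AssumptionOmega S) (hd : 1 ≤ d) :
    BddAbove {t : ℝ | 0 ≤ t ∧ chi S (e1R d t) < ⊤} := by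
  obtain ⟨b, hb0, hb⟩ := hS.exists_not_mem
  refine ⟨b, fun t ht => ?_⟩
  by_contra! hlt
  exact hb (hS.e1R_mem_of_le hd ht.2 hb0.le hlt.le)

theorem AssumptionOmega.exists_gt_mem (hS : AssumptionOmega S) {t : ℝ}
    (ht : e1R d t ∈ Omega S) : ∃ s > t, e1R d s ∈ Omega S := by
  have h1 : ∀ᶠ s in 𝓝 t, e1R d s ∈ Omega S :=
    continuous_e1R.continuousAt.eventually (hS.open_Omega.mem_nhds ht)
  obtain ⟨s, hs, hs'⟩ := ((h1.filter_mono nhdsWithin_le_nhds).and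
    (self_mem_nhdsWithin : Set.Ioi t ∈ 𝓝[>] t)).exists
  exact ⟨s, hs', hs⟩

theorem AssumptionOmega.mass_pos (hS : AssumptionOmega S) (hd : 1 ≤ d) : 0 < mass S := by
  obtain ⟨s, hs, hsm⟩ := hS.exists_gt_mem (t := 0) (by rw [e1R_zero]; exact hS.zero_mem)
  exact hs.trans_le (le_csSup (hS.bddAbove hd) ⟨hs.le, hsm⟩)

theorem AssumptionOmega.e1R_mem (hS : AssumptionOmega S) (hd : 1 ≤ d) {t : ℝ} (h0 : 0 ≤ t)
    (ht : t < mass S) : e1R d t ∈ Omega S := by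
  have hne : {t : ℝ | 0 ≤ t ∧ chi S (e1R d t) < ⊤}.Nonempty :=
    ⟨0, le_rfl, by rw [e1R_zero]; exact hS.zero_mem⟩
  obtain ⟨s, hs, hts⟩ := exists_lt_of_lt_csSup hne ht
  exact hS.e1R_mem_of_le hd hs.2 h0 hts.le

theorem AssumptionOmega.e1R_mass_mem_closure (hS : AssumptionOmega S) (hd : 1 ≤ d) :
    e1R d (mass S) ∈ closure (Omega S) := by
  have : mass S ∈ closure (Set.Ico 0 (mass S)) := by
    rw [closure_Ico (hS.mass_pos hd).ne]
    exact Set.right_mem_Icc.2 (hS.mass_pos hd).le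
  refine map_mem_closure continuous_e1R this fun t ht => hS.e1R_mem hd ht.1 ht.2

theorem AssumptionOmega.e1R_mass_notMem (hS : AssumptionOmega S) (hd : 1 ≤ d) :
    e1R d (mass S) ∉ Omega S := fun hm => by
  obtain ⟨s, hs, hsm⟩ := hS.exists_gt_mem hm
  exact hs.not_ge (le_csSup (hS.bddAbove hd) ⟨(hS.mass_pos hd).le.trans hs.le, hsm⟩)

theorem AssumptionOmega.tendsto_tiltSum (hS : AssumptionOmega S) (hd : 1 ≤ d) :
    Tendsto (fun t => tiltSum S (e1R d t)) (𝓝[<] mass S) atTop := by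
  have hn : ∀ t x, 0 ≤ S x * Real.exp (rdotZ (e1R d t) x) := fun t x =>
    mul_nonneg (hS.nonneg x) (Real.exp_pos _).le
  refine tendsto_atTop.2 fun R => ?_
  obtain ⟨s, hs⟩ : ∃ s : Finset (Fin d → ℤ),
      R < ∑ x ∈ s, S x * Real.exp (rdotZ (e1R d (mass S)) x) := by
    by_contra! hcon
    refine hS.e1R_mass_notMem hd ((mem_Omega_iff hS.nonneg _).2 ?_)
    refine (summable_of_sum_le (hn _) hcon).congr fun x => ?_
    rw [abs_of_nonneg (hS.nonneg x)]
  have hc : Continuous fun t => ∑ x ∈ s, S x * Real.exp (rdotZ (e1R d t) x) := by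
    simp only [rdotZ_e1R hd]
    fun_prop
  have h1 : ∀ᶠ t in 𝓝[<] mass S, t ∈ Set.Ioo 0 (mass S) := Ioo_mem_nhdsLT (hS.mass_pos hd)
  filter_upwards [h1, (hc.continuousAt.eventually (lt_mem_nhds hs)).filter_mono
    nhdsWithin_le_nhds] with t ht hts
  refine hts.le.trans (Summable.sum_le_tsum s (fun x _ => hn t x) ?_)
  refine (hS.expSummable (hS.e1R_mem hd ht.1.le ht.2)).congr fun x => ?_
  rw [abs_of_nonneg (hS.nonneg x)]

theorem AssumptionJ.tendsto_tiltSum_J (hJ : AssumptionJ S J h M K ζ) (hS : AssumptionOmega S)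
    (hd : 1 ≤ d) :
    Tendsto (fun t => tiltSum J (e1R d t)) (𝓝[<] mass S) (𝓝 (tiltSum J (e1R d (mass S)))) := by
  have h1 : ∀ᶠ t in 𝓝[<] mass S, t ∈ Set.Ioo 0 (mass S) := Ioo_mem_nhdsLT (hS.mass_pos hd)
  refine tendsto_tsum_of_dominated_convergence
    (Summable.add (hJ.exp_J (subset_closure hS.zero_mem)).1
      (hJ.exp_J (hS.e1R_mass_mem_closure hd)).1) (fun x => ?_) ?_
  · simp only [rdotZ_e1R hd]
    exact (Continuous.tendsto (by fun_prop) _).mono_left nhdsWithin_le_nhds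
  · filter_upwards [h1] with t ht x
    rw [norm_mul, Real.norm_eq_abs, Real.norm_eq_abs, Real.abs_exp, rdotZ_e1R hd, rdotZ_e1R hd,
      rdotZ_zero, Real.exp_zero, ← mul_add]
    exact mul_le_mul_of_nonneg_left (exp_le_one_add_exp ht.1.le ht.2.le _) (abs_nonneg _)

theorem AssumptionJ.tiltSum_mul (hJ : AssumptionJ S J h M K ζ) (hS : AssumptionOmega S)
    {μ : Fin d → ℝ} (hμ : μ ∈ Omega S) : tiltSum S μ * (1 - tiltSum J μ) = tiltSum h μ := by
  have := laplace_eq_of_conv (w := ofRealVec μ) hJ.OZ_eq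
    (by rw [reVec_ofRealVec]; exact hS.expSummable hμ)
    (by rw [reVec_ofRealVec]; exact (hJ.exp_J (subset_closure hμ)).1)
    (by rw [reVec_ofRealVec]; exact (hJ.exp_h (subset_closure hμ)).1)
  simp only [laplace_ofRealVec] at this
  exact_mod_cast this

theorem AssumptionJ.abs_tiltSum_h_le (hJ : AssumptionJ S J h M K ζ)
    {μ : Fin d → ℝ} (hμ : μ ∈ closure (Omega S)) : |tiltSum h μ| ≤ M := by
  obtain ⟨h1, h2⟩ := hJ.exp_h hμ
  have e : ∀ x, ‖h x * Real.exp (rdotZ μ x)‖ = |h x| * Real.exp (rdotZ μ x) := fun x => by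
    rw [norm_mul, Real.norm_eq_abs, Real.norm_eq_abs, Real.abs_exp]
  refine le_trans ?_ h2
  simp only [← e]
  refine norm_tsum_le_tsum_norm (f := fun x => h x * Real.exp (rdotZ μ x)) ?_
  simp only [e]
  exact h1

theorem AssumptionJ.tiltSum_J_mass (hJ : AssumptionJ S J h M K ζ) (hS : AssumptionOmega S)
    (hd : 1 ≤ d) : tiltSum J (e1R d (mass S)) = 1 := by
  have h1 : ∀ᶠ t in 𝓝[<] mass S, t ∈ Set.Ioo 0 (mass S) := Ioo_mem_nhdsLT (hS.mass_pos hd)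
  have h2 := hS.tendsto_tiltSum hd
  have h3 : Tendsto (fun t => 1 - tiltSum J (e1R d t)) (𝓝[<] mass S) (𝓝 0) := by
    refine squeeze_zero_norm' ?_ (h2.const_div_atTop M)
    filter_upwards [h1, h2.eventually_gt_atTop 0] with t ht hpos
    have hm := hS.e1R_mem hd ht.1.le ht.2
    rw [le_div_iff₀ hpos, Real.norm_eq_abs, ← abs_of_pos hpos, ← abs_mul, mul_comm,
      hJ.tiltSum_mul hS hm]
    exact hJ.abs_tiltSum_h_le (subset_closure hm)
  have h4 := tendsto_nhds_unique h3 ((hJ.tendsto_tiltSum_J hS hd).const_sub 1)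
  linarith

end

/-- A sequence of Ornstein–Zernike systems approaching criticality, with limiting values `s` of
the variance of `J` and `b` of the total sum of `h`. -/
structure CriticalSeq (M K ζ s b : ℝ) (S J h : ℕ → (Fin d → ℤ) → ℝ) : Prop where
  omega : ∀ n, AssumptionOmega (S n)
  assumJ : ∀ n, AssumptionJ (S n) (J n) (h n) M K ζ
  mass_tendsto : Tendsto (fun n => mass (S n)) atTop (𝓝 0)
  s_pos : 0 < s
  b_pos : 0 < b
  sigma_tendsto : Tendsto (fun n => sigmaSq (J n)) atTop (𝓝 s)
  h_tendsto : Tendsto (fun n => h0 (h n)) atTop (𝓝 b)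

theorem laplace_zero (f : (Fin d → ℤ) → ℝ) : laplace f 0 = ((∑' x, f x : ℝ) : ℂ) := by
  simp [laplace, cdot, Complex.ofReal_tsum]

theorem sum_norm_smul (m : ℝ) (hm : 0 ≤ m) (w : Fin d → ℂ) :
    ∑ i, ‖((m : ℂ) • w) i‖ = m * ∑ i, ‖w i‖ := by
  rw [Finset.mul_sum]
  exact Finset.sum_congr rfl fun i _ => by simp [abs_of_nonneg hm]

section

variable {S J h : ℕ → (Fin d → ℤ) → ℝ} {M K ζ s b : ℝ}

theorem CriticalSeq.zero_mem (H : CriticalSeq M K ζ s b S J h) (n : ℕ) :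
    (0 : Fin d → ℝ) ∈ closure (Omega (S n)) := subset_closure (H.omega n).zero_mem

theorem CriticalSeq.tendsto_laplace_h (H : CriticalSeq M K ζ s b S J h) (hd : 1 ≤ d)
    {w : Fin d → ℂ}
    (hw : ∀ n, reVec ((mass (S n) : ℂ) • w) ∈ closure (Omega (S n))) :
    Tendsto (fun n => laplace (h n) ((mass (S n) : ℂ) • w)) atTop (𝓝 b) := by
  have hζ := (H.assumJ 0).zeta_pos
  have hp : 0 < min ζ 1 := lt_min hζ one_pos
  have h1 : Tendsto (fun n => laplace (h n) ((mass (S n) : ℂ) • w) - laplace (h n) 0) atTop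
      (𝓝 0) := by
    refine squeeze_zero_norm (fun n => (H.assumJ n).laplace_h_sub (H.zero_mem n) (hw n) hp
      (min_le_right _ _) (min_le_left _ _)) ?_
    have h2 : Tendsto (fun n => 4 * M * (mass (S n) * ∑ i, ‖w i‖) ^ min ζ 1) atTop
        (𝓝 (4 * M * (0 * ∑ i, ‖w i‖) ^ min ζ 1)) :=
      ((H.mass_tendsto.mul_const _).rpow_const (Or.inr hp.le)).const_mul _
    rw [zero_mul, Real.zero_rpow hp.ne', mul_zero] at h2
    exact h2.congr fun n => by rw [sum_norm_smul _ ((H.omega n).mass_pos hd).le]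
  have h3 : Tendsto (fun n => laplace (h n) 0) atTop (𝓝 (b : ℂ)) := by
    simp only [laplace_zero]
    exact (Complex.continuous_ofReal.tendsto b).comp H.h_tendsto
  simpa using h1.add h3

theorem CriticalSeq.tendsto_laplace_J_sub (H : CriticalSeq M K ζ s b S J h) (hd : 1 ≤ d)
    {w : Fin d → ℂ}
    (hw : ∀ n, reVec ((mass (S n) : ℂ) • w) ∈ closure (Omega (S n))) :
    Tendsto (fun n => (laplace (J n) ((mass (S n) : ℂ) • w) - laplace (J n) 0) /
      (mass (S n) : ℂ) ^ 2) atTop (𝓝 ((∑ i, w i ^ 2) * ((s / (2 * d) : ℝ) : ℂ))) := by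
  have hζ := (H.assumJ 0).zeta_pos
  have hp : 0 < min ζ 1 := lt_min hζ one_pos
  have h1 : Tendsto (fun n => (laplace (J n) ((mass (S n) : ℂ) • w) - laplace (J n) 0) /
      (mass (S n) : ℂ) ^ 2 - (∑ i, w i ^ 2) * ((sigmaSq (J n) / (2 * d) : ℝ) : ℂ)) atTop
      (𝓝 0) := by
    have h2 : Tendsto (fun n => 6 * M * (∑ i, ‖w i‖) ^ (2 + min ζ 1) * mass (S n) ^ min ζ 1) atTop
        (𝓝 (6 * M * (∑ i, ‖w i‖) ^ (2 + min ζ 1) * 0 ^ min ζ 1)) :=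
      (H.mass_tendsto.rpow_const (Or.inr hp.le)).const_mul _
    rw [Real.zero_rpow hp.ne', mul_zero] at h2
    refine squeeze_zero_norm (fun n => ?_) h2
    have hm := (H.omega n).mass_pos hd
    have hmC : (mass (S n) : ℂ) ≠ 0 := Complex.ofReal_ne_zero.2 hm.ne'
    have h3 := (H.assumJ n).laplace_J_expansion hd (H.zero_mem n) (hw n) hp
      (min_le_right _ _) (min_le_left _ _)
    rw [sum_norm_smul _ hm.le, Real.mul_rpow hm.le (Finset.sum_nonneg fun _ _ => norm_nonneg _),
      Real.rpow_add hm, Real.rpow_two] at h3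
    have e : (laplace (J n) ((mass (S n) : ℂ) • w) - laplace (J n) 0) /
      (mass (S n) : ℂ) ^ 2 - (∑ i, w i ^ 2) * ((sigmaSq (J n) / (2 * d) : ℝ) : ℂ) =
      (laplace (J n) ((mass (S n) : ℂ) • w) - laplace (J n) 0 -
        (∑ i, ((mass (S n) : ℂ) • w) i ^ 2) * ((sigmaSq (J n) / d : ℝ) : ℂ) / 2) /
        (mass (S n) : ℂ) ^ 2 := by
      have e2 : ∑ i, ((mass (S n) : ℂ) • w) i ^ 2 = (mass (S n) : ℂ) ^ 2 * ∑ i, w i ^ 2 := by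
        rw [Finset.mul_sum]
        exact Finset.sum_congr rfl fun i _ => by simp [mul_pow]
      have hd' : (d : ℂ) ≠ 0 := by exact_mod_cast (by omega : d ≠ 0)
      rw [e2]
      push_cast
      field_simp
    rw [e, norm_div, norm_pow, Complex.norm_real, Real.norm_eq_abs, abs_of_pos hm,
      div_le_iff₀ (by positivity)]
    refine h3.trans (le_of_eq ?_)
    ring
  have h4 : Tendsto (fun n => (∑ i, w i ^ 2) * ((sigmaSq (J n) / (2 * d) : ℝ) : ℂ)) atTop
      (𝓝 ((∑ i, w i ^ 2) * ((s / (2 * d) : ℝ) : ℂ))) :=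
    ((Complex.continuous_ofReal.tendsto _).comp (H.sigma_tendsto.div_const _)).const_mul _
  simpa using h1.add h4

theorem smul_ofRealVec_e1R (m t : ℝ) :
    (m : ℂ) • ofRealVec (e1R d t) = ofRealVec (e1R d (t * m)) := by
  ext i
  simp only [ofRealVec, e1R, Pi.smul_apply, smul_eq_mul]
  split_ifs <;> push_cast <;> ring

theorem sum_ofRealVec_e1R_sq (hd : 1 ≤ d) (t : ℝ) :
    ∑ i, ofRealVec (e1R d t) i ^ 2 = (t : ℂ) ^ 2 := by
  rw [Finset.sum_eq_single (⟨0, hd⟩ : Fin d)]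
  · simp [e1R, ofRealVec]
  · intro i _ hi
    have : (i : ℕ) ≠ 0 := fun h => hi (Fin.ext h)
    simp [e1R, ofRealVec, this]
  · simp

theorem CriticalSeq.tendsto_one_sub_laplace_J (H : CriticalSeq M K ζ s b S J h) (hd : 1 ≤ d)
    {w : Fin d → ℂ}
    (hw : ∀ n, reVec ((mass (S n) : ℂ) • w) ∈ closure (Omega (S n))) :
    Tendsto (fun n => (1 - laplace (J n) ((mass (S n) : ℂ) • w)) / (mass (S n) : ℂ) ^ 2) atTop
      (𝓝 ((1 - ∑ i, w i ^ 2) * ((s / (2 * d) : ℝ) : ℂ))) := by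
  have h1 := H.tendsto_laplace_J_sub hd (w := ofRealVec (e1R d 1)) fun n => by
    rw [smul_ofRealVec_e1R, reVec_ofRealVec, one_mul]
    exact (H.omega n).e1R_mass_mem_closure hd
  rw [sum_ofRealVec_e1R_sq hd] at h1
  have h2 := h1.sub (H.tendsto_laplace_J_sub hd hw)
  convert h2 using 2 with n
  · rw [smul_ofRealVec_e1R, one_mul, laplace_ofRealVec, (H.assumJ n).tiltSum_J_mass (H.omega n) hd]
    push_cast; ring
  · push_cast; ring

theorem CriticalSeq.tendsto_laplace_S (H : CriticalSeq M K ζ s b S J h) (hd : 1 ≤ d)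
    {w : Fin d → ℂ} (hw : ∀ n, reVec ((mass (S n) : ℂ) • w) ∈ Omega (S n))
    (hw1 : ∑ i, w i ^ 2 ≠ 1) :
    Tendsto (fun n => (mass (S n) : ℂ) ^ 2 * laplace (S n) ((mass (S n) : ℂ) • w)) atTop
      (𝓝 ((2 * d * b / s : ℝ) / (1 - ∑ i, w i ^ 2))) := by
  have hw' := fun n => subset_closure (hw n)
  have hs : (s : ℂ) ≠ 0 := by exact_mod_cast H.s_pos.ne'
  have hd' : (d : ℂ) ≠ 0 := by exact_mod_cast (by omega : d ≠ 0)
  have hw2 : 1 - ∑ i, w i ^ 2 ≠ 0 := sub_ne_zero.2 hw1.symm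
  have hne : (1 - ∑ i, w i ^ 2) * ((s / (2 * d) : ℝ) : ℂ) ≠ 0 := by
    refine mul_ne_zero hw2 ?_
    push_cast
    exact div_ne_zero hs (mul_ne_zero two_ne_zero hd')
  have h1 := H.tendsto_one_sub_laplace_J hd hw'
  have h2 := (H.tendsto_laplace_h hd hw').div h1 hne
  have e : (b : ℂ) / ((1 - ∑ i, w i ^ 2) * ((s / (2 * d) : ℝ) : ℂ)) =
      (2 * d * b / s : ℝ) / (1 - ∑ i, w i ^ 2) := by
    push_cast; field_simp
  rw [e] at h2
  refine h2.congr' ?_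
  filter_upwards [h1.eventually_ne hne] with n hn
  have h3 : 1 - laplace (J n) ((mass (S n) : ℂ) • w) ≠ 0 := fun h0 => hn (by rw [h0, zero_div])
  have hmC : (mass (S n) : ℂ) ≠ 0 := Complex.ofReal_ne_zero.2 ((H.omega n).mass_pos hd).ne'
  have h4 := laplace_eq_of_conv (H.assumJ n).OZ_eq ((H.omega n).expSummable (hw n))
    ((H.assumJ n).exp_J (hw' n)).1 ((H.assumJ n).exp_h (hw' n)).1
  simp only [Pi.div_apply]
  rw [← h4]
  field_simp

end

/-- Polynomial growth is dominated by exponential growth on the half-line. -/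
theorem exists_rpow_le_exp {q c : ℝ} (hq : 0 ≤ q) (hc : 0 < c) :
    ∃ C : ℝ, 0 < C ∧ ∀ r : ℝ, 0 ≤ r → r ^ q ≤ C * Real.exp (c * r) := by
  set n := ⌈q⌉₊
  refine ⟨1 + n.factorial / c ^ n, by positivity, fun r hr => ?_⟩
  have h1 : r ^ q ≤ 1 + r ^ n := by
    rcases le_total r 1 with h | h
    · have := Real.rpow_le_one hr h hq
      have := pow_nonneg hr n
      linarith
    · have := Real.rpow_le_rpow_of_exponent_le h (Nat.le_ceil q)
      rw [Real.rpow_natCast] at this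
      linarith
  have h2 := Real.pow_div_factorial_le_exp (c * r) (by positivity) n
  have h3 : 1 ≤ Real.exp (c * r) := Real.one_le_exp (by positivity)
  have h4 : r ^ n ≤ n.factorial / c ^ n * Real.exp (c * r) := by
    rw [mul_pow, div_le_iff₀ (by positivity)] at h2
    rw [div_mul_eq_mul_div, le_div_iff₀ (by positivity)]
    linarith
  nlinarith

theorem exists_enormZ_le (hd : 1 ≤ d) (x : Fin d → ℤ) : ∃ i, enormZ x ≤ d * |(x i : ℝ)| := by
  have : Nonempty (Fin d) := ⟨⟨0, hd⟩⟩
  obtain ⟨i, hi⟩ := Finite.exists_max fun i => |(x i : ℝ)|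
  have hd' : (1 : ℝ) ≤ d := by exact_mod_cast hd
  refine ⟨i, Real.sqrt_le_iff.2 ⟨by positivity, ?_⟩⟩
  calc ∑ j, (x j : ℝ) ^ 2 ≤ ∑ _j : Fin d, |(x i : ℝ)| ^ 2 :=
        Finset.sum_le_sum fun j _ =>
          (sq_abs _).symm.le.trans (pow_le_pow_left₀ (abs_nonneg _) (hi j) 2)
    _ = d * |(x i : ℝ)| ^ 2 := by simp
    _ ≤ (d * |(x i : ℝ)|) ^ 2 := by
        rw [mul_pow]; gcongr; nlinarith

theorem exists_enormZ_rpow_le (hd : 1 ≤ d) {q : ℝ} (hq : 0 ≤ q) :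
    ∃ C : ℝ, 0 < C ∧ ∀ (m : ℝ), 0 ≤ m → ∀ x : Fin d → ℤ, (m * enormZ x) ^ q ≤
      C * ∑ i, (Real.exp (1 / 2 * m * (x i : ℝ)) + Real.exp (-(1 / 2 * m * (x i : ℝ)))) := by
  have hd' : (0 : ℝ) < d := by exact_mod_cast hd
  obtain ⟨C, hC, hle⟩ := exists_rpow_le_exp hq (c := 1 / (2 * d)) (by positivity)
  refine ⟨C, hC, fun m hm x => (hle _ (mul_nonneg hm (enormZ_nonneg x))).trans ?_⟩
  gcongr
  obtain ⟨i, hi⟩ := exists_enormZ_le hd x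
  refine le_trans ?_ (Finset.single_le_sum (f := fun i =>
    Real.exp (1 / 2 * m * (x i : ℝ)) + Real.exp (-(1 / 2 * m * (x i : ℝ))))
    (fun _ _ => by positivity) (Finset.mem_univ i))
  have h1 : 1 / (2 * d) * (m * enormZ x) ≤ |1 / 2 * m * (x i : ℝ)| := by
    rw [abs_mul, abs_of_nonneg (show 0 ≤ 1 / 2 * m by positivity)]
    calc 1 / (2 * d) * (m * enormZ x) ≤ 1 / (2 * d) * (m * (d * |(x i : ℝ)|)) := by gcongr
      _ = _ := by field_simp
  refine (Real.exp_le_exp.2 h1).trans ?_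
  rcases abs_choice (1 / 2 * m * (x i : ℝ)) with h | h <;> rw [h]
  · linarith [Real.exp_pos (-(1 / 2 * m * (x i : ℝ)))]
  · linarith [Real.exp_pos (1 / 2 * m * (x i : ℝ))]

theorem hasSum_exp_coord {f : (Fin d → ℤ) → ℝ} (hd : 1 ≤ d) (hf : ZdSymmetric f) {t : ℝ}
    (hs : Summable fun x => f x * Real.exp (rdotZ (e1R d t) x)) (i : Fin d) :
    HasSum (fun x => f x * Real.exp (t * (x i : ℝ))) (tiltSum f (e1R d t)) := by
  have h1 := summable_swap hf i ⟨0, hd⟩ fun x => Real.exp (t * (x ⟨0, hd⟩ : ℝ))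
  have h2 := tsum_swap hf i ⟨0, hd⟩ fun x => Real.exp (t * (x ⟨0, hd⟩ : ℝ))
  simp only [swapPerm_apply, Equiv.swap_apply_right, ← rdotZ_e1R hd] at h1 h2
  rw [tiltSum, ← h2]
  exact (h1.2 hs).hasSum

theorem hasSum_exp_neg_coord {f : (Fin d → ℤ) → ℝ} (hd : 1 ≤ d) (hf : ZdSymmetric f) {t : ℝ}
    (hs : Summable fun x => f x * Real.exp (rdotZ (e1R d t) x)) (i : Fin d) :
    HasSum (fun x => f x * Real.exp (-(t * (x i : ℝ)))) (tiltSum f (e1R d t)) := by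
  have h0 := hasSum_exp_coord hd hf hs i
  have h1 := summable_flip hf (fun _ => true) fun x => Real.exp (t * (x i : ℝ))
  have h2 := tsum_flip hf (fun _ => true) fun x => Real.exp (t * (x i : ℝ))
  simp only [flipPerm_apply, if_true, Int.cast_neg, mul_neg] at h1 h2
  rw [← h0.tsum_eq, ← h2]
  exact (h1.2 h0.summable).hasSum

theorem exists_moment_le (hd : 1 ≤ d) {q : ℝ} (hq : 0 ≤ q) :
    ∃ C : ℝ, 0 < C ∧ ∀ (m : ℝ) (f : (Fin d → ℤ) → ℝ), 0 ≤ m → (∀ x, 0 ≤ f x) → ZdSymmetric f →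
      (Summable fun x => f x * Real.exp (rdotZ (e1R d (1 / 2 * m)) x)) →
      (Summable fun x => f x * (m * enormZ x) ^ q) ∧
      ∑' x, f x * (m * enormZ x) ^ q ≤ C * tiltSum f (e1R d (1 / 2 * m)) := by
  obtain ⟨C, hC, hle⟩ := exists_enormZ_rpow_le hd hq
  have hd' : (0 : ℝ) < d := by exact_mod_cast hd
  refine ⟨C * (2 * d), by positivity, fun m f hm hf0 hf hs => ?_⟩
  have h1 := (hasSum_sum fun i (_ : i ∈ Finset.univ) =>
    (hasSum_exp_coord hd hf hs i).add (hasSum_exp_neg_coord hd hf hs i)).mul_left C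
  have h2 : ∀ x, f x * (m * enormZ x) ^ q ≤ C * ∑ i, (f x * Real.exp (1 / 2 * m * (x i : ℝ)) +
      f x * Real.exp (-(1 / 2 * m * (x i : ℝ)))) := fun x => by
    refine (mul_le_mul_of_nonneg_left (hle m hm x) (hf0 x)).trans (le_of_eq ?_)
    simp only [← mul_add, ← Finset.mul_sum]
    ring
  have h3 : Summable fun x => f x * (m * enormZ x) ^ q :=
    h1.summable.of_nonneg_of_le (fun x => mul_nonneg (hf0 x)
      (Real.rpow_nonneg (mul_nonneg hm (enormZ_nonneg x)) _)) h2
  refine ⟨h3, (h3.tsum_le_tsum h2 h1.summable).trans (le_of_eq ?_)⟩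
  rw [h1.tsum_eq]
  simp
  ring

/-- The law of `m • x` when `x` has probability proportional to `f x`. -/
def scaledLaw (f : (Fin d → ℤ) → ℝ) (m : ℝ) : Measure (Euc d) :=
  Measure.sum fun x => ENNReal.ofReal (f x / suscept f) •
    Measure.dirac (WithLp.toLp 2 fun i => m * (x i : ℝ))

theorem norm_toLp_mul {m : ℝ} (hm : 0 ≤ m) (x : Fin d → ℤ) :
    ‖(WithLp.toLp 2 fun i => m * (x i : ℝ) : Euc d)‖ = m * enormZ x := by
  rw [EuclideanSpace.norm_eq, enormZ, ← Real.sqrt_sq hm, ← Real.sqrt_mul (sq_nonneg _),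
    Real.sqrt_sq hm, Finset.mul_sum]
  simp [mul_pow]

section

variable {f : (Fin d → ℤ) → ℝ}

theorem toReal_weight (hf : ∀ x, 0 ≤ f x) (x : Fin d → ℤ) :
    (ENNReal.ofReal (f x / suscept f)).toReal = f x / suscept f :=
  ENNReal.toReal_ofReal (div_nonneg (hf x) (tsum_nonneg hf))

theorem isProbabilityMeasure_scaledLaw (hf : ∀ x, 0 ≤ f x) (hχ : 0 < suscept f) (m : ℝ) :
    IsProbabilityMeasure (scaledLaw f m) := by
  have hs : Summable f := by
    by_contra h
    exact hχ.ne' (tsum_eq_zero_of_not_summable h)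
  refine ⟨?_⟩
  rw [scaledLaw, Measure.sum_apply _ MeasurableSet.univ]
  simp only [Measure.smul_apply, measure_univ, smul_eq_mul, mul_one]
  rw [← ENNReal.ofReal_tsum_of_nonneg (fun x => div_nonneg (hf x) hχ.le) (hs.div_const _),
    tsum_div_const, ← suscept, div_self hχ.ne', ENNReal.ofReal_one]

theorem integral_scaledLaw {F : Type*} [NormedAddCommGroup F] [NormedSpace ℝ F]
    [FiniteDimensional ℝ F] (hf : ∀ x, 0 ≤ f x) (m : ℝ) (g : Euc d → F) :
    ∫ y, g y ∂scaledLaw f m =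
      ∑' x, (f x / suscept f) • g (WithLp.toLp 2 fun i => m * (x i : ℝ)) := by
  rw [scaledLaw, integral_sum_dirac fun _ => ENNReal.ofReal_ne_top]
  simp only [toReal_weight hf]

theorem integral_norm_rpow_scaledLaw (hf : ∀ x, 0 ≤ f x) {m : ℝ} (hm : 0 ≤ m) (q : ℝ) :
    ∫ y, ‖y‖ ^ q ∂scaledLaw f m = (∑' x, f x * (m * enormZ x) ^ q) / suscept f := by
  rw [integral_scaledLaw hf, ← tsum_div_const]
  exact tsum_congr fun x => by rw [norm_toLp_mul hm, smul_eq_mul]; ring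

theorem integrable_norm_rpow_scaledLaw (hf : ∀ x, 0 ≤ f x) {m : ℝ} (hm : 0 ≤ m) {q : ℝ}
    (hs : Summable fun x => f x * (m * enormZ x) ^ q) :
    Integrable (fun y => ‖y‖ ^ q) (scaledLaw f m) := by
  refine integrable_sum_dirac (fun _ => ENNReal.ofReal_ne_top) ?_
  refine (hs.div_const (suscept f)).congr fun x => ?_
  rw [toReal_weight hf, norm_toLp_mul hm, Real.norm_of_nonneg
    (Real.rpow_nonneg (mul_nonneg hm (enormZ_nonneg x)) _)]
  ring

theorem charFun_scaledLaw (hf : ∀ x, 0 ≤ f x) (m : ℝ) (k : Euc d) :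
    charFun (scaledLaw f m) k =
      laplace f ((m : ℂ) • fun i => Complex.I * (k i : ℂ)) / (suscept f : ℂ) := by
  rw [charFun_apply, integral_scaledLaw hf, laplace, ← tsum_div_const]
  refine tsum_congr fun x => ?_
  have e : (inner ℝ (WithLp.toLp 2 fun i => m * (x i : ℝ) : Euc d) k : ℂ) * Complex.I =
      cdot ((m : ℂ) • fun i => Complex.I * (k i : ℂ)) x := by
    rw [PiLp.inner_apply, cdot]
    push_cast
    rw [Finset.sum_mul]
    exact Finset.sum_congr rfl fun i _ => by simp; ring
  rw [e, Complex.real_smul]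
  push_cast
  ring

end

theorem AssumptionJ.suscept_pos {S J h : (Fin d → ℤ) → ℝ} {M K ζ : ℝ}
    (hJ : AssumptionJ S J h M K ζ) (hS : AssumptionOmega S) : 0 < suscept S := by
  have h1 := hJ.tiltSum_mul hS hS.zero_mem
  have h2 := hJ.hhat_pos 0 (subset_closure hS.zero_mem)
  have h3 : tiltSum S 0 = suscept S := by simp [tiltSum, suscept, rdotZ_zero]
  refine (tsum_nonneg hS.nonneg).lt_of_ne fun h0 => ?_
  rw [h3, suscept, ← h0, zero_mul] at h1
  exact h2.ne h1

theorem tendsto_ofReal_complex {ι : Type*} {l : Filter ι} {f : ι → ℝ} {a : ℝ}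
    (hf : Tendsto (fun n => (f n : ℂ)) l (𝓝 (a : ℂ))) : Tendsto f l (𝓝 a) := by
  exact (Complex.continuous_re.tendsto _).comp hf

section

variable {S J h : ℕ → (Fin d → ℤ) → ℝ} {M K ζ s b : ℝ}

theorem CriticalSeq.tendsto_suscept (H : CriticalSeq M K ζ s b S J h) (hd : 1 ≤ d) :
    Tendsto (fun n => mass (S n) ^ 2 * suscept (S n)) atTop (𝓝 (2 * d * b / s)) := by
  have h1 := H.tendsto_laplace_S hd (w := 0) (fun n => by
    rw [smul_zero, reVec_zero]; exact (H.omega n).zero_mem) (by simp)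
  simp only [smul_zero, laplace_zero] at h1
  refine tendsto_ofReal_complex (Tendsto.congr (fun n => ?_) (h1.trans (le_of_eq ?_)))
  · rw [suscept]; push_cast; rfl
  · simp

theorem CriticalSeq.tendsto_tiltSum_half (H : CriticalSeq M K ζ s b S J h) (hd : 1 ≤ d) :
    Tendsto (fun n => mass (S n) ^ 2 * tiltSum (S n) (e1R d (1 / 2 * mass (S n)))) atTop
      (𝓝 (2 * d * b / s / (3 / 4))) := by
  have h1 := H.tendsto_laplace_S hd (w := ofRealVec (e1R d (1 / 2))) (fun n => by
    have := (H.omega n).mass_pos hd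
    rw [smul_ofRealVec_e1R, reVec_ofRealVec]
    exact (H.omega n).e1R_mem hd (by positivity) (by linarith)) (by
    rw [sum_ofRealVec_e1R_sq hd]; norm_num)
  simp only [smul_ofRealVec_e1R, laplace_ofRealVec, sum_ofRealVec_e1R_sq hd] at h1
  refine tendsto_ofReal_complex (Tendsto.congr (fun n => ?_) (h1.trans (le_of_eq ?_)))
  · push_cast; rfl
  · norm_num

theorem CriticalSeq.const_pos (H : CriticalSeq M K ζ s b S J h) (hd : 1 ≤ d) :
    0 < 2 * d * b / s := by
  have := H.s_pos
  have := H.b_pos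
  have hd' : (0 : ℝ) < d := by exact_mod_cast hd
  positivity

theorem CriticalSeq.tendsto_charFun (H : CriticalSeq M K ζ s b S J h) (hd : 1 ≤ d) (k : Euc d) :
    Tendsto (fun n => charFun (scaledLaw (S n) (mass (S n))) k) atTop
      (𝓝 (charFun (greenLaw d) k)) := by
  have hre : reVec (fun i => Complex.I * (k i : ℂ)) = 0 := by ext; simp [reVec]
  have hsq : ∑ i, (Complex.I * (k i : ℂ)) ^ 2 = ((-‖k‖ ^ 2 : ℝ) : ℂ) := by
    rw [EuclideanSpace.norm_sq_eq]
    simp [mul_pow]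
  have h1 := H.tendsto_laplace_S hd (w := fun i => Complex.I * (k i : ℂ)) (fun n => by
    have : reVec ((mass (S n) : ℂ) • fun i => Complex.I * (k i : ℂ)) = 0 := by
      ext; simp [reVec]
    rw [this]; exact (H.omega n).zero_mem) (by
    rw [hsq]
    norm_cast
    have := sq_nonneg ‖k‖
    intro h0; linarith)
  have hc : ((2 * d * b / s : ℝ) : ℂ) ≠ 0 := Complex.ofReal_ne_zero.2 (H.const_pos hd).ne'
  have h2 := h1.div ((Complex.continuous_ofReal.tendsto _).comp (H.tendsto_suscept hd)) hc
  rw [charFun_greenLaw hd]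
  refine Tendsto.congr (fun n => ?_) (h2.trans (le_of_eq ?_))
  · have hm : (mass (S n) : ℂ) ≠ 0 := Complex.ofReal_ne_zero.2 ((H.omega n).mass_pos hd).ne'
    have hχ : (suscept (S n) : ℂ) ≠ 0 :=
      Complex.ofReal_ne_zero.2 ((H.assumJ n).suscept_pos (H.omega n)).ne'
    rw [charFun_scaledLaw (H.omega n).nonneg]
    simp only [Pi.div_apply, Function.comp_apply]
    push_cast
    field_simp
  · rw [hsq, div_right_comm, div_self hc]
    push_cast
    ring_nf

theorem CriticalSeq.tendsto_moment (H : CriticalSeq M K ζ s b S J h) (hd : 1 ≤ d) {q : ℝ}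
    (hq : 0 ≤ q) :
    Tendsto (fun n => (∑' x, S n x * (mass (S n) * enormZ x) ^ q) / suscept (S n)) atTop
      (𝓝 (Aconst d q / 2)) := by
  have hm := fun n => (H.omega n).mass_pos hd
  have hχ := fun n => (H.assumJ n).suscept_pos (H.omega n)
  obtain ⟨C, hC, hmom⟩ := exists_moment_le hd (q := q * 2) (by positivity)
  have hmom' := fun n => hmom (mass (S n)) (S n) (hm n).le (H.omega n).nonneg (H.omega n).symm (by
    have := (H.omega n).expSummable ((H.omega n).e1R_mem hd (t := 1 / 2 * mass (S n))
      (by linarith [hm n]) (by linarith [hm n]))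
    exact this.congr fun x => by rw [abs_of_nonneg ((H.omega n).nonneg x)])
  have := isProbabilityMeasure_greenLaw hd
  have hprob := fun n => isProbabilityMeasure_scaledLaw (H.omega n).nonneg (hχ n) (mass (S n))
  let P : ℕ → ProbabilityMeasure (Euc d) := fun n => ⟨scaledLaw (S n) (mass (S n)), hprob n⟩
  let P₀ : ProbabilityMeasure (Euc d) := ⟨greenLaw d, this⟩
  have hP : Tendsto P atTop (𝓝 P₀) :=
    ProbabilityMeasure.tendsto_of_tendsto_charFun fun k => H.tendsto_charFun hd k
  have hsq : (fun y : Euc d => (‖y‖ ^ q) ^ 2) = fun y => ‖y‖ ^ (q * 2) := by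
    ext y; rw [Real.rpow_mul (norm_nonneg y), Real.rpow_two]
  have hbound : ∀ᶠ n in atTop, ∫ y, (‖y‖ ^ q) ^ 2 ∂(P n : Measure (Euc d)) ≤
      C * (2 * d * b / s / (3 / 4) / (2 * d * b / s)) + 1 := by
    have h1 := ((H.tendsto_tiltSum_half hd).div (H.tendsto_suscept hd)
      (H.const_pos hd).ne').const_mul C
    filter_upwards [h1.eventually_le_const (lt_add_one _)] with n hn
    refine le_trans ?_ hn
    rw [hsq]
    change ∫ y, ‖y‖ ^ (q * 2) ∂scaledLaw (S n) (mass (S n)) ≤ _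
    rw [integral_norm_rpow_scaledLaw (H.omega n).nonneg (hm n).le, Pi.div_apply,
      mul_div_mul_left _ _ (by have := hm n; positivity), ← mul_div_assoc]
    have := hχ n
    gcongr
    exact (hmom' n).2
  have key := tendsto_integral_of_sq_bounded hP (f := fun y : Euc d => ‖y‖ ^ q)
    (continuous_norm.rpow_const fun _ => Or.inr hq)
    (fun y => Real.rpow_nonneg (norm_nonneg y) _) (fun n => by
      rw [hsq]
      exact integrable_norm_rpow_scaledLaw (H.omega n).nonneg (hm n).le (hmom' n).1) hbound (by
      rw [hsq]
      exact integrable_norm_rpow_greenLaw hd (by positivity))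
  rw [show ∫ y, ‖y‖ ^ q ∂(P₀ : Measure (Euc d)) = Aconst d q / 2 from
    integral_norm_rpow_greenLaw q] at key
  exact key.congr fun n => integral_norm_rpow_scaledLaw (H.omega n).nonneg (hm n).le q

theorem tsum_mul_scaled_rpow {f : (Fin d → ℤ) → ℝ} {m : ℝ} (hm : 0 ≤ m) (q : ℝ) :
    ∑' x, f x * (m * enormZ x) ^ q = m ^ q * ∑' x, enormZ x ^ q * f x := by
  rw [← tsum_mul_left]
  exact tsum_congr fun x => by rw [Real.mul_rpow hm (enormZ_nonneg x)]; ring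

theorem CriticalSeq.tendsto_mass_rpow_mul (H : CriticalSeq M K ζ s b S J h) (hd : 1 ≤ d) {q : ℝ}
    (hq : 0 ≤ q) :
    Tendsto (fun n => mass (S n) ^ (2 + q) * ∑' x, enormZ x ^ q * S n x) atTop
      (𝓝 (Aconst d q * d * b / s)) := by
  have h1 := (H.tendsto_suscept hd).mul (H.tendsto_moment hd hq)
  rw [show 2 * d * b / s * (Aconst d q / 2) = Aconst d q * d * b / s by ring] at h1
  refine h1.congr fun n => ?_
  have hm := (H.omega n).mass_pos hd
  have hχ := (H.assumJ n).suscept_pos (H.omega n)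
  rw [tsum_mul_scaled_rpow hm.le, Real.rpow_add hm, Real.rpow_two]
  field_simp

theorem CriticalSeq.tendsto_mass_mul_xiPhi (H : CriticalSeq M K ζ s b S J h) (hd : 1 ≤ d) {q : ℝ}
    (hq : 0 < q) :
    Tendsto (fun n => mass (S n) * xiPhi (S n) q) atTop
      (𝓝 ((Aconst d q / Aconst d 0) ^ (1 / q))) := by
  have h1 := (H.tendsto_moment hd hq.le).rpow_const (p := 1 / q) (Or.inr (by positivity))
  rw [Aconst_zero hd]
  refine h1.congr fun n => ?_
  have hm := (H.omega n).mass_pos hd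
  have hχ := (H.assumJ n).suscept_pos (H.omega n)
  rw [tsum_mul_scaled_rpow hm.le, xiPhi, mul_div_assoc, Real.mul_rpow (by positivity) (div_nonneg
    (tsum_nonneg fun x => mul_nonneg (Real.rpow_nonneg (enormZ_nonneg x) _)
      ((H.omega n).nonneg x)) hχ.le), ← Real.rpow_mul hm.le, mul_one_div_cancel hq.ne',
    Real.rpow_one]

end

theorem tendsto_of_criticalSeq {δ zc M K ζ s b : ℝ} {S J h : ℝ → (Fin d → ℤ) → ℝ}
    (hfam : CriticalFamily d δ zc M K ζ S J h) (hs : 0 < s) (hb : 0 < b)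
    (hslim : Tendsto (fun z => sigmaSq (J z)) (𝓝[<] zc) (𝓝 s))
    (hblim : Tendsto (fun z => h0 (h z)) (𝓝[<] zc) (𝓝 b))
    {F : ((Fin d → ℤ) → ℝ) → ℝ} {a : ℝ}
    (hF : ∀ S J h : ℕ → (Fin d → ℤ) → ℝ, CriticalSeq M K ζ s b S J h →
      Tendsto (fun n => F (S n)) atTop (𝓝 a)) :
    Tendsto (fun z => F (S z)) (𝓝[<] zc) (𝓝 a) := by
  refine tendsto_of_seq_tendsto fun u hu => ?_
  have hmem : ∀ᶠ n in atTop, u n ∈ Set.Ico (zc - δ) zc :=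
    hu.eventually (Ico_mem_nhdsLT (by linarith [hfam.δ_pos]))
  obtain ⟨N, hN⟩ := eventually_atTop.1 hmem
  rw [← tendsto_add_atTop_iff_nat N]
  have hu' := hu.comp (tendsto_add_atTop_nat N)
  have hN' : ∀ n, u (n + N) ∈ Set.Ico (zc - δ) zc := fun n => hN _ (Nat.le_add_left _ _)
  exact hF (fun n => S (u (n + N))) (fun n => J (u (n + N))) (fun n => h (u (n + N)))
    ⟨fun n => hfam.assumOmega _ (hN' n), fun n => hfam.assumJ _ (hN' n),
      hfam.mass_tendsto.comp hu', hs, hb, hslim.comp hu', hblim.comp hu'⟩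

theorem statement11 (d : ℕ) (hd : 1 ≤ d) (δ zc M K ζ σstar hstar : ℝ)
    (S J h : ℝ → (Fin d → ℤ) → ℝ)
    (hfam : CriticalFamily d δ zc M K ζ S J h)
    (hlow : ∀ z ∈ Set.Ico (zc - δ) zc, ∀ μ ∈ closure (Omega (S z)), M⁻¹ ≤ tiltSum (h z) μ)
    (hσpos : 0 < σstar) (hhpos : 0 < hstar)
    (hσlim : Tendsto (fun z => sigmaSq (J z)) (𝓝[<] zc) (𝓝 (σstar ^ 2)))
    (hhlim : Tendsto (fun z => h0 (h z)) (𝓝[<] zc) (𝓝 hstar)) :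
    (∀ φ : ℝ, 0 ≤ φ →
      Tendsto (fun z => mass (S z) ^ (2 + φ) * ∑' x, enormZ x ^ φ * S z x)
        (𝓝[<] zc) (𝓝 (Aconst d φ * (d : ℝ) * hstar / σstar ^ 2))) ∧
    (∀ φ : ℝ, 0 < φ →
      Tendsto (fun z => mass (S z) * xiPhi (S z) φ) (𝓝[<] zc)
        (𝓝 ((Aconst d φ / Aconst d 0) ^ (1 / φ))) ∧
      (Aconst d φ / Aconst d 0) ^ (1 / φ) =
        2 * (Real.Gamma ((φ + 2) / 2) * Real.Gamma ((φ + (d : ℝ)) / 2) /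
          Real.Gamma ((d : ℝ) / 2)) ^ (1 / φ)) := by
  have hs : 0 < σstar ^ 2 := by positivity
  refine ⟨fun φ hφ => ?_, fun φ hφ => ⟨?_, Aconst_ratio_rpow hd hφ⟩⟩
  · exact tendsto_of_criticalSeq hfam hs hhpos hσlim hhlim
      (F := fun T => mass T ^ (2 + φ) * ∑' x, enormZ x ^ φ * T x)
      fun _ _ _ H => H.tendsto_mass_rpow_mul hd hφ
  · exact tendsto_of_criticalSeq hfam hs hhpos hσlim hhlim
      (F := fun T => mass T * xiPhi T φ) fun _ _ _ H => H.tendsto_mass_mul_xiPhi hd hφ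

end OZpaper
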